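/- arXiv:1604.04165 — 2 statements merged into one kernel-verified Lean document; each statement's English description precedes it below -/
import Mathlib

section
/- In the coordinate transport setting, let f : Ω → ℝ be C³ and let T be the (0,1)-tensor with components T_i = ∂_i f. Then the weighted tensor Laplacian of T satisfies, for every x ∈ Ω and every index i: (LT)_i = Σ_{m,k} Φ^{mk} f_{imk} − Σ Φ_{iab} Φ^{am} Φ^{bk} f_{mk} − Σ_m W^m f_{mi} + ½ Σ_{k,m} (V_{ik} − Ŵ_{ik}) Φ^{km} f_m + ¼ Σ_{k,m} g_{ik} Φ^{km} f_m, where f_m, f_{mk}, f_{imk} denote partial derivatives of f. -/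
noncomputable section
open scoped BigOperators
open Filter MeasureTheory

/-- Partial derivative `∂_i f`. -/
def pd {n : ℕ} (f : (Fin n → ℝ) → ℝ) (i : Fin n) : (Fin n → ℝ) → ℝ :=
  fun x => fderiv ℝ f x (Pi.single i 1)

/-- Second partial derivative `f_{ij}`. -/
def pd2 {n : ℕ} (f : (Fin n → ℝ) → ℝ) (i j : Fin n) : (Fin n → ℝ) → ℝ :=
  pd (pd f i) j

/-- Third partial derivative `f_{ijk}`. -/
def pd3 {n : ℕ} (f : (Fin n → ℝ) → ℝ) (i j k : Fin n) : (Fin n → ℝ) → ℝ :=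
  pd (pd2 f i j) k

/-- Fourth partial derivative `f_{ijkl}`. -/
def pd4 {n : ℕ} (f : (Fin n → ℝ) → ℝ) (i j k l : Fin n) : (Fin n → ℝ) → ℝ :=
  pd (pd3 f i j k) l

/-- Fifth partial derivative. -/
def pd5 {n : ℕ} (f : (Fin n → ℝ) → ℝ) (i j k l m : Fin n) : (Fin n → ℝ) → ℝ :=
  pd (pd4 f i j k l) m

/-- The Hessian matrix `D²Φ(x)`, with entries `Φ_{ij}(x)`. -/
def hess {n : ℕ} (Φ : (Fin n → ℝ) → ℝ) (x : Fin n → ℝ) : Matrix (Fin n) (Fin n) ℝ :=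
  Matrix.of fun i j => pd2 Φ i j x

/-- The inverse Hessian matrix, with entries `Φ^{ij}(x)`. -/
def ihess {n : ℕ} (Φ : (Fin n → ℝ) → ℝ) (x : Fin n → ℝ) : Matrix (Fin n) (Fin n) ℝ :=
  (hess Φ x)⁻¹

/-- The gradient `∇Φ(x)`. -/
def grad {n : ℕ} (Φ : (Fin n → ℝ) → ℝ) (x : Fin n → ℝ) : Fin n → ℝ :=
  fun i => pd Φ i x

/-- The Calabi tensor `g_{ij} = Σ Φ_{iab} Φ_{jcd} Φ^{ac} Φ^{bd}`. -/
def calabi {n : ℕ} (Φ : (Fin n → ℝ) → ℝ) (i j : Fin n) (x : Fin n → ℝ) : ℝ :=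
  ∑ a, ∑ b, ∑ c, ∑ d,
    pd3 Φ i a b x * pd3 Φ j c d x * ihess Φ x a c * ihess Φ x b d

/-- `W^i := (∂_i W)(∇Φ)`. -/
def Wop {n : ℕ} (Φ W : (Fin n → ℝ) → ℝ) (i : Fin n) (x : Fin n → ℝ) : ℝ :=
  pd W i (grad Φ x)

/-- `Ŵ_{ij} := Σ_{a,b} W^{ab} Φ_{ai} Φ_{bj}` where `W^{ab} = (∂²_{ab}W)(∇Φ)`. -/
def What2 {n : ℕ} (Φ W : (Fin n → ℝ) → ℝ) (i j : Fin n) (x : Fin n → ℝ) : ℝ :=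
  ∑ a, ∑ b, pd2 W a b (grad Φ x) * pd2 Φ a i x * pd2 Φ b j x

/-- `Ŵ_{ijk} := Σ_{a,b,c} W^{abc} Φ_{ai} Φ_{bj} Φ_{ck}` where `W^{abc} = (∂³_{abc}W)(∇Φ)`. -/
def What3 {n : ℕ} (Φ W : (Fin n → ℝ) → ℝ) (i j k : Fin n) (x : Fin n → ℝ) : ℝ :=
  ∑ a, ∑ b, ∑ c, pd3 W a b c (grad Φ x) * pd2 Φ a i x * pd2 Φ b j x * pd2 Φ c k x

/-- Christoffel symbols `Γ^k_{pq} = ½ Σ_m Φ^{km} Φ_{mpq}` of the Hessian metric. -/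
def Γh {n : ℕ} (Φ : (Fin n → ℝ) → ℝ) (k p q : Fin n) (x : Fin n → ℝ) : ℝ :=
  (1/2) * ∑ m, ihess Φ x k m * pd3 Φ m p q x

/-- Covariant derivative of a (0,1)-tensor: `(∇T)_{p i}`. -/
def covD1 {n : ℕ} (Φ : (Fin n → ℝ) → ℝ) (T : Fin n → (Fin n → ℝ) → ℝ)
    (p i : Fin n) (x : Fin n → ℝ) : ℝ :=
  pd (T i) p x - ∑ m, Γh Φ m p i x * T m x

/-- Covariant derivative of a (0,2)-tensor: `(∇T)_{p i j}`. -/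
def covD2 {n : ℕ} (Φ : (Fin n → ℝ) → ℝ) (T : Fin n → Fin n → (Fin n → ℝ) → ℝ)
    (p i j : Fin n) (x : Fin n → ℝ) : ℝ :=
  pd (T i j) p x - ∑ m, Γh Φ m p i x * T m j x - ∑ m, Γh Φ m p j x * T i m x

/-- Covariant derivative of a (0,3)-tensor: `(∇T)_{p i j k}`. -/
def covD3 {n : ℕ} (Φ : (Fin n → ℝ) → ℝ) (T : Fin n → Fin n → Fin n → (Fin n → ℝ) → ℝ)
    (p i j k : Fin n) (x : Fin n → ℝ) : ℝ :=
  pd (T i j k) p x - ∑ m, Γh Φ m p i x * T m j k x - ∑ m, Γh Φ m p j x * T i m k x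
    - ∑ m, Γh Φ m p k x * T i j m x

/-- Covariant derivative of a (0,4)-tensor: `(∇T)_{p i j k l}`. -/
def covD4 {n : ℕ} (Φ : (Fin n → ℝ) → ℝ)
    (T : Fin n → Fin n → Fin n → Fin n → (Fin n → ℝ) → ℝ)
    (p i j k l : Fin n) (x : Fin n → ℝ) : ℝ :=
  pd (T i j k l) p x - ∑ m, Γh Φ m p i x * T m j k l x - ∑ m, Γh Φ m p j x * T i m k l x
    - ∑ m, Γh Φ m p k x * T i j m l x - ∑ m, Γh Φ m p l x * T i j k m x

/-- Weighted tensor Laplacian of a (0,1)-tensor: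
`(LT)_i = Σ Φ^{pq}(∇∇T)_{pq i} − ½ Σ_p (Σ_m Φ^{pm} V_m + W^p)(∇T)_{p i}`. -/
def LT1 {n : ℕ} (Φ V W : (Fin n → ℝ) → ℝ) (T : Fin n → (Fin n → ℝ) → ℝ)
    (i : Fin n) (x : Fin n → ℝ) : ℝ :=
  (∑ p, ∑ q, ihess Φ x p q * covD2 Φ (covD1 Φ T) p q i x)
    - (1/2) * ∑ p, ((∑ m, ihess Φ x p m * pd V m x) + Wop Φ W p x) * covD1 Φ T p i x

/-- Weighted tensor Laplacian of a (0,2)-tensor. -/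
def LT2 {n : ℕ} (Φ V W : (Fin n → ℝ) → ℝ) (T : Fin n → Fin n → (Fin n → ℝ) → ℝ)
    (i j : Fin n) (x : Fin n → ℝ) : ℝ :=
  (∑ p, ∑ q, ihess Φ x p q * covD3 Φ (covD2 Φ T) p q i j x)
    - (1/2) * ∑ p, ((∑ m, ihess Φ x p m * pd V m x) + Wop Φ W p x) * covD2 Φ T p i j x

/-- Weighted tensor Laplacian of a (0,3)-tensor. -/
def LT3 {n : ℕ} (Φ V W : (Fin n → ℝ) → ℝ) (T : Fin n → Fin n → Fin n → (Fin n → ℝ) → ℝ)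
    (i j k : Fin n) (x : Fin n → ℝ) : ℝ :=
  (∑ p, ∑ q, ihess Φ x p q * covD4 Φ (covD3 Φ T) p q i j k x)
    - (1/2) * ∑ p, ((∑ m, ihess Φ x p m * pd V m x) + Wop Φ W p x) * covD3 Φ T p i j k x

/-- `N_{piab} := Φ_{piab} − ½ Σ_{k,m} Φ^{km}(Φ_{mpi}Φ_{kab} + Φ_{mpa}Φ_{kib} + Φ_{mpb}Φ_{kia})`. -/
def Ncal {n : ℕ} (Φ : (Fin n → ℝ) → ℝ) (p i a b : Fin n) (x : Fin n → ℝ) : ℝ :=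
  pd4 Φ p i a b x - (1/2) * ∑ k, ∑ m, ihess Φ x k m *
    (pd3 Φ m p i x * pd3 Φ k a b x + pd3 Φ m p a x * pd3 Φ k i b x
      + pd3 Φ m p b x * pd3 Φ k i a x)

/-- Riemann curvature `R_{ikjl} := ¼ Σ_{a,m} Φ^{am}(Φ_{ila}Φ_{mkj} − Φ_{ija}Φ_{mkl})`. -/
def Rcal {n : ℕ} (Φ : (Fin n → ℝ) → ℝ) (i k j l : Fin n) (x : Fin n → ℝ) : ℝ :=
  (1/4) * ∑ a, ∑ m, ihess Φ x a m *
    (pd3 Φ i l a x * pd3 Φ m k j x - pd3 Φ i j a x * pd3 Φ m k l x)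

/-- The `h`-norm of a quadratic form `Q` at `x`:
`‖Q‖_h(x) = sup { Σ Q_{ij} v_i v_j : Σ Φ_{ij}(x) v_i v_j = 1 }`. -/
def hnorm {n : ℕ} (Φ : (Fin n → ℝ) → ℝ) (Q : Fin n → Fin n → ℝ) (x : Fin n → ℝ) : ℝ :=
  sSup {r | ∃ v : Fin n → ℝ,
    (∑ i, ∑ j, pd2 Φ i j x * v i * v j) = 1 ∧ r = ∑ i, ∑ j, Q i j * v i * v j}

/-- The matrix `A(x)` with entries `V_{ab} + Ŵ_{ab}`. -/
def Amat {n : ℕ} (Φ V W : (Fin n → ℝ) → ℝ) (x : Fin n → ℝ) : Matrix (Fin n) (Fin n) ℝ :=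
  Matrix.of fun a b => pd2 V a b x + What2 Φ W a b x

/-- The matrix `S_i(x)` with entries `V_{iab} − Ŵ_{iab}`. -/
def Smat {n : ℕ} (Φ V W : (Fin n → ℝ) → ℝ) (i : Fin n) (x : Fin n → ℝ) :
    Matrix (Fin n) (Fin n) ℝ :=
  Matrix.of fun a b => pd3 V i a b x - What3 Φ W i a b x

/-- `H_{ij}(x) := Tr[A(x)⁻¹ · S_i(x) · (D²Φ(x))⁻¹ · S_j(x)]`. -/
def Hten {n : ℕ} (Φ V W : (Fin n → ℝ) → ℝ) (i j : Fin n) (x : Fin n → ℝ) : ℝ :=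
  ((Amat Φ V W x)⁻¹ * Smat Φ V W i x * (hess Φ x)⁻¹ * Smat Φ V W j x).trace

/-- Euclidean operator norm of a matrix. -/
def eOpNorm {n : ℕ} (M : Matrix (Fin n) (Fin n) ℝ) : ℝ :=
  ‖LinearMap.toContinuousLinearMap (Matrix.toEuclideanLin M)‖

/-- Directional derivative of the Hessian: the matrix `∂_e D²F(x)`. -/
def dirHess {n : ℕ} (F : (Fin n → ℝ) → ℝ) (e : Fin n → ℝ) (x : Fin n → ℝ) :
    Matrix (Fin n) (Fin n) ℝ :=
  Matrix.of fun i j => ∑ k, e k * pd3 F k i j x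

/-- The quadratic form `⟨Qy, y⟩`. -/
def qform {n : ℕ} (Q : Matrix (Fin n) (Fin n) ℝ) (y : Fin n → ℝ) : ℝ :=
  ∑ i, ∑ j, Q i j * y j * y i

section PartialDerivatives

variable {n : ℕ} {f g : (Fin n → ℝ) → ℝ} {x : Fin n → ℝ}

lemma contDiffAt_pd {k m : WithTop ℕ∞} (hf : ContDiffAt ℝ m f x) (hkm : k + 1 ≤ m) (i : Fin n) :
    ContDiffAt ℝ k (pd f i) x :=
  (hf.fderiv_right hkm).clm_apply contDiffAt_const

lemma pd_congr (h : f =ᶠ[nhds x] g) (i : Fin n) : pd f i x = pd g i x := by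
  simp only [pd, h.fderiv_eq]

lemma pd_mul (hf : DifferentiableAt ℝ f x) (hg : DifferentiableAt ℝ g x) (i : Fin n) :
    pd (fun y => f y * g y) i x = pd f i x * g x + f x * pd g i x := by
  simp only [pd, fderiv_fun_mul hf hg, _root_.add_apply,
    _root_.smul_apply, smul_eq_mul]
  ring

lemma pd_sub (hf : DifferentiableAt ℝ f x) (hg : DifferentiableAt ℝ g x) (i : Fin n) :
    pd (fun y => f y - g y) i x = pd f i x - pd g i x := by
  simp only [pd, fderiv_fun_sub hf hg, _root_.sub_apply]

lemma pd_const_mul (hf : DifferentiableAt ℝ f x) (c : ℝ) (i : Fin n) :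
    pd (fun y => c * f y) i x = c * pd f i x := by
  simp only [pd, fderiv_const_mul hf, _root_.smul_apply, smul_eq_mul]

lemma pd_const (c : ℝ) (i : Fin n) : pd (fun _ => c) i x = 0 := by
  simp [pd]

lemma pd_sum {ι : Type*} {s : Finset ι} {F : ι → (Fin n → ℝ) → ℝ}
    (hF : ∀ j ∈ s, DifferentiableAt ℝ (F j) x) (i : Fin n) :
    pd (fun y => ∑ j ∈ s, F j y) i x = ∑ j ∈ s, pd (F j) i x := by
  simp only [pd, fderiv_fun_sum hF, _root_.sum_apply]

lemma pd_sum_mul {ι : Type*} {s : Finset ι} {F G : ι → (Fin n → ℝ) → ℝ}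
    (hF : ∀ j, DifferentiableAt ℝ (F j) x) (hG : ∀ j, DifferentiableAt ℝ (G j) x) (i : Fin n) :
    pd (fun y => ∑ j ∈ s, F j y * G j y) i x
      = ∑ j ∈ s, (pd (F j) i x * G j x + F j x * pd (G j) i x) := by
  rw [pd_sum fun j _ => (hF j).fun_mul (hG j)]
  simp only [pd_mul (hF _) (hG _)]

lemma pd_log (hf : DifferentiableAt ℝ f x) (hx : f x ≠ 0) (i : Fin n) :
    pd (fun y => Real.log (f y)) i x = (f x)⁻¹ * pd f i x := by
  simp only [pd, fderiv.log hf hx, _root_.smul_apply, smul_eq_mul]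

lemma pd2_comm (hf : ContDiffAt ℝ 2 f x) (i j : Fin n) : pd2 f i j x = pd2 f j i x := by
  have hd : DifferentiableAt ℝ (fderiv ℝ f) x :=
    (hf.fderiv_right (m := 1) (by norm_num)).differentiableAt (by norm_num)
  have hsymm := hf.isSymmSndFDerivAt (by simp)
  have key (a b : Fin n) :
      pd2 f a b x = fderiv ℝ (fderiv ℝ f) x (Pi.single b 1) (Pi.single a 1) := by
    change fderiv ℝ (fun y => fderiv ℝ f y (Pi.single a 1)) x (Pi.single b 1) = _
    rw [fderiv_clm_apply hd (differentiableAt_const _)]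
    simp
  rw [key, key, hsymm.eq]

lemma pd2_comm_eventuallyEq (hf : ContDiffAt ℝ 2 f x) (i j : Fin n) :
    pd2 f i j =ᶠ[nhds x] pd2 f j i := by
  filter_upwards [hf.eventually (by simp)] with y hy using pd2_comm hy i j

lemma pd3_comm_left (hf : ContDiffAt ℝ 2 f x) (i j k : Fin n) :
    pd3 f i j k x = pd3 f j i k x :=
  pd_congr (pd2_comm_eventuallyEq hf i j) k

lemma pd3_comm_right (hf : ContDiffAt ℝ 3 f x) (i j k : Fin n) :
    pd3 f i j k x = pd3 f i k j x :=
  pd2_comm (contDiffAt_pd (k := 2) hf (by norm_num) i) j k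

lemma pd4_comm_left (hf : ContDiffAt ℝ 2 f x) (i j k l : Fin n) :
    pd4 f i j k l x = pd4 f j i k l x := by
  refine pd_congr ?_ l
  filter_upwards [hf.eventually (by simp)] with y hy using pd3_comm_left hy i j k

lemma pd4_comm_middle (hf : ContDiffAt ℝ 3 f x) (i j k l : Fin n) :
    pd4 f i j k l x = pd4 f i k j l x :=
  pd3_comm_left (contDiffAt_pd (k := 2) hf (by norm_num) i) j k l

lemma pd4_comm_right (hf : ContDiffAt ℝ 4 f x) (i j k l : Fin n) :
    pd4 f i j k l x = pd4 f i j l k x :=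
  pd3_comm_right (contDiffAt_pd (k := 3) hf (by norm_num) i) j k l

/-- The chain rule for composition with a gradient map. -/
lemma pd_comp_grad {Φ W : (Fin n → ℝ) → ℝ} (hW : DifferentiableAt ℝ W (grad Φ x))
    (hΦ : ∀ a, DifferentiableAt ℝ (pd Φ a) x) (m : Fin n) :
    DifferentiableAt ℝ (fun y => W (grad Φ y)) x ∧
    pd (fun y => W (grad Φ y)) m x = ∑ a, pd W a (grad Φ x) * pd2 Φ a m x := by
  have hg : DifferentiableAt ℝ (grad Φ) x := differentiableAt_pi.2 hΦ
  refine ⟨hW.comp x hg, ?_⟩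
  have h1 : pd (fun y => W (grad Φ y)) m x
      = fderiv ℝ W (grad Φ x) (fderiv ℝ (grad Φ) x (Pi.single m 1)) := by
    simp only [pd]
    rw [show (fun y => W (grad Φ y)) = W ∘ grad Φ from rfl, fderiv_comp x hW hg]
    rfl
  have h2 : fderiv ℝ (grad Φ) x (Pi.single m 1) = fun a => pd2 Φ a m x := by
    have hpi : fderiv ℝ (grad Φ) x = ContinuousLinearMap.pi fun a => fderiv ℝ (pd Φ a) x :=
      fderiv_pi hΦ
    rw [hpi]
    rfl
  rw [h1, h2, pi_eq_sum_univ' (fun a => pd2 Φ a m x), map_sum]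
  refine Finset.sum_congr rfl fun a _ => ?_
  rw [map_smul, smul_eq_mul, mul_comm]
  simp only [pd]

end PartialDerivatives

section MatrixCalculus

variable {n : ℕ} {A : (Fin n → ℝ) → Matrix (Fin n) (Fin n) ℝ} {x : Fin n → ℝ}

/-- Jacobi's formula for the partial derivatives of a determinant. -/
lemma pd_det (hA : ∀ i j, DifferentiableAt ℝ (fun y => A y i j) x) (m : Fin n) :
    DifferentiableAt ℝ (fun y => (A y).det) x ∧
    pd (fun y => (A y).det) m x
      = ∑ a, ∑ b, (A x).adjugate b a * pd (fun y => A y a b) m x := by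
  let D : ContinuousMultilinearMap ℝ (fun _ : Fin n => Fin n → ℝ) ℝ :=
    { toMultilinearMap := (Matrix.detRowAlternating (R := ℝ) (n := Fin n)).toMultilinearMap
      cont := Continuous.matrix_det continuous_id }
  have hrow (a : Fin n) : HasFDerivAt (fun y => A y a)
      (ContinuousLinearMap.pi fun b => fderiv ℝ (fun y => A y a b) x) x :=
    hasFDerivAt_pi.2 fun b => (hA a b).hasFDerivAt
  have h : HasFDerivAt (fun y => (A y).det) _ x := HasFDerivAt.multilinear_comp D hrow
  refine ⟨h.differentiableAt, ?_⟩
  simp only [pd, h.fderiv, _root_.sum_apply, ContinuousLinearMap.comp_apply]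
  refine Finset.sum_congr rfl fun a _ => ?_
  change ((A x).updateRow a fun b => fderiv ℝ (fun y => A y a b) x (Pi.single m 1)).det = _
  rw [← Matrix.cramer_transpose_apply, Matrix.cramer_eq_adjugate_mulVec,
    ← Matrix.adjugate_transpose]
  rfl

lemma differentiableAt_inv_apply (hA : ∀ i j, DifferentiableAt ℝ (fun y => A y i j) x)
    (hdet : (A x).det ≠ 0) (i j : Fin n) : DifferentiableAt ℝ (fun y => (A y)⁻¹ i j) x := by
  have hadj : DifferentiableAt ℝ (fun y => (A y).adjugate i j) x := by
    simp only [Matrix.adjugate_apply]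
    refine (pd_det (fun a b => ?_) i).1
    by_cases ha : a = j
    · subst ha
      simp
    · simpa [Matrix.updateRow_ne ha] using hA a b
  simp only [Matrix.inv_def, Matrix.smul_apply, smul_eq_mul, Ring.inverse_eq_inv']
  exact ((pd_det hA i).1.inv hdet).mul hadj

lemma pd_inv_apply (hA : ∀ i j, DifferentiableAt ℝ (fun y => A y i j) x)
    (hdet : (A x).det ≠ 0) (i j p : Fin n) :
    pd (fun y => (A y)⁻¹ i j) p x
      = -∑ b, ∑ c, (A x)⁻¹ i b * pd (fun y => A y b c) p x * (A x)⁻¹ c j := by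
  have hinv := differentiableAt_inv_apply hA hdet
  set I : Matrix (Fin n) (Fin n) ℝ := Matrix.of fun a b => pd (fun y => (A y)⁻¹ a b) p x with hI
  set B : Matrix (Fin n) (Fin n) ℝ := Matrix.of fun a b => pd (fun y => A y a b) p x with hB
  have hzero : I * A x + (A x)⁻¹ * B = 0 := by
    ext a c
    have hev : (fun y => ∑ b, (A y)⁻¹ a b * A y b c) =ᶠ[nhds x]
        fun _ => (1 : Matrix (Fin n) (Fin n) ℝ) a c := by
      filter_upwards [(pd_det hA p).1.continuousAt.eventually_ne hdet] with y hy
      rw [← Matrix.nonsing_inv_mul (A y) (isUnit_iff_ne_zero.2 hy), Matrix.mul_apply]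
    have hd := pd_congr hev p
    rw [pd_const, pd_sum_mul (hinv a) fun b => hA b c, Finset.sum_add_distrib] at hd
    simpa [Matrix.mul_apply, hI, hB] using hd
  have hIeq : I = -((A x)⁻¹ * B * (A x)⁻¹) := by
    have h := congrArg (· * (A x)⁻¹) hzero
    simp only [add_mul, Matrix.mul_assoc,
      Matrix.mul_nonsing_inv (A x) (isUnit_iff_ne_zero.2 hdet), mul_one, zero_mul] at h
    rw [Matrix.mul_assoc]
    exact eq_neg_of_add_eq_zero_left h
  have h := congrFun (congrFun hIeq i) j
  simp only [hI, hB, Matrix.neg_apply, Matrix.mul_apply, Matrix.of_apply, Finset.sum_mul] at h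
  rw [h, Finset.sum_comm]

end MatrixCalculus

section HessianMetric

variable {n : ℕ} {Φ f : (Fin n → ℝ) → ℝ} {x : Fin n → ℝ}

lemma ihess_comm (hΦ : ContDiffAt ℝ 2 Φ x) (a b : Fin n) : ihess Φ x a b = ihess Φ x b a := by
  have h : (hess Φ x).transpose = hess Φ x := by
    ext i j
    exact pd2_comm hΦ j i
  have hinv := Matrix.transpose_nonsing_inv (hess Φ x)
  rw [h] at hinv
  exact congrFun (congrFun hinv b) a

lemma differentiableAt_pd2 (hΦ : ContDiffAt ℝ 3 Φ x) (a b : Fin n) :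
    DifferentiableAt ℝ (pd2 Φ a b) x :=
  (contDiffAt_pd (k := 1) (contDiffAt_pd (k := 2) hΦ (by norm_num) a) (by norm_num)
    b).differentiableAt (by norm_num)

lemma differentiableAt_pd3 (hΦ : ContDiffAt ℝ 4 Φ x) (a b c : Fin n) :
    DifferentiableAt ℝ (pd3 Φ a b c) x :=
  differentiableAt_pd2 (contDiffAt_pd (k := 3) hΦ (by norm_num) a) b c

lemma differentiableAt_ihess (hΦ : ContDiffAt ℝ 3 Φ x) (hpos : (hess Φ x).PosDef) (a b : Fin n) :
    DifferentiableAt ℝ (fun y => ihess Φ y a b) x :=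
  differentiableAt_inv_apply (A := hess Φ) (differentiableAt_pd2 hΦ) hpos.det_pos.ne' a b

lemma pd_ihess (hΦ : ContDiffAt ℝ 3 Φ x) (hpos : (hess Φ x).PosDef) (a b p : Fin n) :
    pd (fun y => ihess Φ y a b) p x
      = -∑ c, ∑ d, ihess Φ x a c * pd3 Φ c d p x * ihess Φ x d b :=
  pd_inv_apply (A := hess Φ) (differentiableAt_pd2 hΦ) hpos.det_pos.ne' a b p

lemma sum_ihess_mul_pd2 (hpos : (hess Φ x).PosDef) (a b : Fin n) :
    ∑ k, ihess Φ x a k * pd2 Φ k b x = if a = b then 1 else 0 := by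
  have h := Matrix.nonsing_inv_mul (hess Φ x) (isUnit_iff_ne_zero.2 hpos.det_pos.ne')
  have hab := congrFun (congrFun h a) b
  rwa [Matrix.mul_apply, Matrix.one_apply] at hab

/-- The components `Σ_m Φ^{km} f_m` of the gradient of `f` for the Hessian metric. -/
def metricGrad (Φ f : (Fin n → ℝ) → ℝ) (k : Fin n) (x : Fin n → ℝ) : ℝ :=
  ∑ m, ihess Φ x k m * pd f m x

lemma differentiableAt_metricGrad (hΦ : ContDiffAt ℝ 3 Φ x) (hpos : (hess Φ x).PosDef)
    (hf : ContDiffAt ℝ 2 f x) (k : Fin n) : DifferentiableAt ℝ (metricGrad Φ f k) x :=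
  DifferentiableAt.fun_sum fun m _ => (differentiableAt_ihess hΦ hpos k m).fun_mul
    ((contDiffAt_pd (k := 1) hf (by norm_num) m).differentiableAt (by norm_num))

lemma pd_metricGrad (hΦ : ContDiffAt ℝ 3 Φ x) (hpos : (hess Φ x).PosDef)
    (hf : ContDiffAt ℝ 2 f x) (k p : Fin n) :
    pd (metricGrad Φ f k) p x
      = ∑ d, ihess Φ x k d * (pd2 f d p x - ∑ c, pd3 Φ d c p x * metricGrad Φ f c x) := by
  have h := pd_sum_mul (s := Finset.univ) (differentiableAt_ihess hΦ hpos k)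
    (fun m => (contDiffAt_pd (k := 1) hf (by norm_num) m).differentiableAt (by norm_num)) p
  change pd (fun y => ∑ m, ihess Φ y k m * pd f m y) p x = _
  rw [h, Finset.sum_add_distrib]
  simp only [pd_ihess hΦ hpos, mul_sub, Finset.sum_sub_distrib]
  rw [add_comm, sub_eq_add_neg]
  congr 1
  simp only [neg_mul, Finset.sum_neg_distrib, metricGrad, Finset.mul_sum, Finset.sum_mul]
  rw [Finset.sum_comm]
  congr 1
  refine Finset.sum_congr rfl fun d _ => ?_
  rw [Finset.sum_comm]
  exact Finset.sum_congr rfl fun c _ => Finset.sum_congr rfl fun m _ => by ring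

/-- The covariant Hessian of `f` in terms of its metric gradient. -/
lemma covD1_pd (hΦ : ContDiffAt ℝ 2 Φ x) (p i : Fin n) :
    covD1 Φ (fun i => pd f i) p i x
      = pd2 f i p x - 1 / 2 * ∑ k, pd3 Φ k p i x * metricGrad Φ f k x := by
  simp only [covD1, Γh, metricGrad, Finset.mul_sum, Finset.sum_mul]
  rw [Finset.sum_comm]
  congr 1
  exact Finset.sum_congr rfl fun k _ => Finset.sum_congr rfl fun m _ => by
    rw [ihess_comm hΦ m k]
    ring

lemma pd_covD1_pd (hΦ : ContDiffAt ℝ 4 Φ x) (hpos : (hess Φ x).PosDef)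
    (hf : ContDiffAt ℝ 3 f x) (p q i : Fin n) :
    pd (covD1 Φ (fun i => pd f i) q i) p x
      = pd3 f i q p x - 1 / 2 * ∑ k, (pd4 Φ k q i p x * metricGrad Φ f k x
          + pd3 Φ k q i x * pd (metricGrad Φ f k) p x) := by
  have hev : covD1 Φ (fun i => pd f i) q i =ᶠ[nhds x] fun y =>
      pd2 f i q y - 1 / 2 * ∑ k, pd3 Φ k q i y * metricGrad Φ f k y := by
    filter_upwards [hΦ.eventually (by simp)] with y hy
      using covD1_pd (hy.of_le (by norm_num)) q i
  have hC (k : Fin n) := differentiableAt_pd3 hΦ k q i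
  have hU := differentiableAt_metricGrad (hΦ.of_le (by norm_num)) hpos
    (hf.of_le (by norm_num))
  have hs : DifferentiableAt ℝ (fun y => ∑ k, pd3 Φ k q i y * metricGrad Φ f k y) x :=
    DifferentiableAt.fun_sum fun k _ => (hC k).fun_mul (hU k)
  rw [pd_congr hev, pd_sub (differentiableAt_pd2 hf i q) (hs.const_mul _), pd_const_mul hs,
    pd_sum_mul hC hU]
  rfl

/-- Contraction of `Φ_{i··}` with a bilinear form `X` in the Hessian metric. -/
def thirdContraction (Φ : (Fin n → ℝ) → ℝ) (X : Fin n → Fin n → ℝ) (i : Fin n)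
    (x : Fin n → ℝ) : ℝ :=
  ∑ a, ∑ b, ∑ m, ∑ k, pd3 Φ i a b x * ihess Φ x a m * ihess Φ x b k * X m k

lemma thirdContraction_sub (X Y : Fin n → Fin n → ℝ) (i : Fin n) :
    thirdContraction Φ (fun m k => X m k - Y m k) i x
      = thirdContraction Φ X i x - thirdContraction Φ Y i x := by
  simp only [thirdContraction, mul_sub, Finset.sum_sub_distrib]

lemma thirdContraction_const_mul (c : ℝ) (X : Fin n → Fin n → ℝ) (i : Fin n) :
    thirdContraction Φ (fun m k => c * X m k) i x = c * thirdContraction Φ X i x := by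
  simp only [thirdContraction, Finset.mul_sum, mul_left_comm]

lemma thirdContraction_pd3 (u : Fin n → ℝ) (i : Fin n) :
    thirdContraction Φ (fun m q => ∑ k, pd3 Φ k m q x * u k) i x
      = ∑ k, calabi Φ i k x * u k := by
  simp only [thirdContraction, calabi, Finset.mul_sum, Finset.sum_mul]
  conv_rhs => rw [Finset.sum_comm]
  refine Finset.sum_congr rfl fun a _ => ?_
  conv_rhs => rw [Finset.sum_comm]
  refine Finset.sum_congr rfl fun b _ => ?_
  conv_rhs => rw [Finset.sum_comm]
  refine Finset.sum_congr rfl fun m _ => ?_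
  conv_rhs => rw [Finset.sum_comm]
  exact Finset.sum_congr rfl fun q _ => Finset.sum_congr rfl fun k _ => by ring

lemma sum_ihess_pd3_mul (hΦ : ContDiffAt ℝ 3 Φ x) (X : Fin n → Fin n → ℝ) (i : Fin n) :
    ∑ p, ∑ q, ihess Φ x p q * ∑ k, pd3 Φ k q i x * ∑ d, ihess Φ x k d * X d p
      = thirdContraction Φ X i x := by
  simp only [thirdContraction, Finset.mul_sum]
  calc
    _ = ∑ q, ∑ p, ∑ k, ∑ d, ihess Φ x p q * (pd3 Φ k q i x * (ihess Φ x k d * X d p)) :=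
      Finset.sum_comm
    _ = ∑ q, ∑ k, ∑ d, ∑ p, ihess Φ x p q * (pd3 Φ k q i x * (ihess Φ x k d * X d p)) := by
      refine Finset.sum_congr rfl fun q _ => ?_
      rw [Finset.sum_comm]
      exact Finset.sum_congr rfl fun k _ => Finset.sum_comm
    _ = ∑ k, ∑ q, ∑ d, ∑ p, ihess Φ x p q * (pd3 Φ k q i x * (ihess Φ x k d * X d p)) :=
      Finset.sum_comm
    _ = _ := by
      refine Finset.sum_congr rfl fun k _ => Finset.sum_congr rfl fun q _ =>
        Finset.sum_congr rfl fun d _ => Finset.sum_congr rfl fun p _ => ?_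
      rw [ihess_comm (hΦ.of_le (by norm_num)) p q, pd3_comm_right hΦ k q i,
        pd3_comm_left (hΦ.of_le (by norm_num)) k i q]
      ring

lemma sum_ihess_Γh_mul (hΦ : ContDiffAt ℝ 3 Φ x) (X : Fin n → Fin n → ℝ) (i : Fin n) :
    ∑ p, ∑ q, ihess Φ x p q * ∑ m, Γh Φ m p i x * X m q
      = 1 / 2 * thirdContraction Φ X i x := by
  rw [← sum_ihess_pd3_mul hΦ, Finset.sum_comm]
  simp only [Γh, Finset.mul_sum, Finset.sum_mul]
  refine Finset.sum_congr rfl fun q _ => Finset.sum_congr rfl fun p _ => ?_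
  rw [Finset.sum_comm]
  refine Finset.sum_congr rfl fun k _ => Finset.sum_congr rfl fun m _ => ?_
  rw [ihess_comm (hΦ.of_le (by norm_num)) p q, ihess_comm (hΦ.of_le (by norm_num)) m k]
  ring

end HessianMetric

section MongeAmpere

variable {n : ℕ} {Ω : Set (Fin n → ℝ)} {Φ V W : (Fin n → ℝ) → ℝ} {x : Fin n → ℝ}

/-- The logarithmic first derivative of the Monge–Ampère equation. -/
lemma sum_ihess_mul_pd3 (hΩ : IsOpen Ω) (hΦ : ContDiffOn ℝ 5 Φ Ω)
    (hpos : ∀ x ∈ Ω, (hess Φ x).PosDef) (hW : ContDiff ℝ 3 W)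
    (hMA : ∀ x ∈ Ω, Real.exp (-V x) = Real.exp (-W (grad Φ x)) * (hess Φ x).det)
    (hx : x ∈ Ω) (m : Fin n) :
    ∑ a, ∑ b, ihess Φ x a b * pd3 Φ a b m x = (∑ a, Wop Φ W a x * pd2 Φ a m x) - pd V m x := by
  have hΦx : ContDiffAt ℝ 3 Φ x := (hΦ.contDiffAt (hΩ.mem_nhds hx)).of_le (by norm_num)
  have hev : V =ᶠ[nhds x] fun y => W (grad Φ y) - Real.log (hess Φ y).det := by
    filter_upwards [hΩ.mem_nhds hx] with y hy
    have h := congrArg Real.log (hMA y hy)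
    rw [Real.log_mul (Real.exp_ne_zero _) (hpos y hy).det_pos.ne', Real.log_exp,
      Real.log_exp] at h
    linarith
  have hdet0 := (hpos x hx).det_pos.ne'
  obtain ⟨hdet, hpdet⟩ := pd_det (A := hess Φ) (differentiableAt_pd2 hΦx) m
  obtain ⟨hWd, hpW⟩ := pd_comp_grad (hW.differentiable (by norm_num) (grad Φ x))
    (fun a => (contDiffAt_pd (k := 2) hΦx (by norm_num) a).differentiableAt (by norm_num)) m
  rw [pd_congr hev, pd_sub hWd (hdet.log hdet0), pd_log hdet hdet0, hpW, hpdet]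
  simp only [Wop, sub_sub_cancel, Finset.mul_sum]
  refine Finset.sum_congr rfl fun a _ => Finset.sum_congr rfl fun b _ => ?_
  rw [ihess_comm (hΦx.of_le (by norm_num)) a b, ihess, Matrix.inv_def, Matrix.smul_apply,
    smul_eq_mul, Ring.inverse_eq_inv', mul_assoc]
  rfl

/-- The logarithmic second derivative of the Monge–Ampère equation. -/
lemma sum_ihess_mul_pd4 (hΩ : IsOpen Ω) (hΦ : ContDiffOn ℝ 5 Φ Ω)
    (hpos : ∀ x ∈ Ω, (hess Φ x).PosDef) (hV : ContDiffOn ℝ 3 V Ω) (hW : ContDiff ℝ 3 W)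
    (hMA : ∀ x ∈ Ω, Real.exp (-V x) = Real.exp (-W (grad Φ x)) * (hess Φ x).det)
    (hx : x ∈ Ω) (i k : Fin n) :
    ∑ a, ∑ b, ihess Φ x a b * pd4 Φ a b i k x
      = What2 Φ W i k x + (∑ a, Wop Φ W a x * pd3 Φ a i k x) + calabi Φ i k x - pd2 V i k x := by
  have hΦ4 : ContDiffAt ℝ 4 Φ x := (hΦ.contDiffAt (hΩ.mem_nhds hx)).of_le (by norm_num)
  have hΦ3 : ContDiffAt ℝ 3 Φ x := hΦ4.of_le (by norm_num)
  have hVx : ContDiffAt ℝ 3 V x := hV.contDiffAt (hΩ.mem_nhds hx)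
  have hev : (fun y => ∑ a, ∑ b, ihess Φ y a b * pd3 Φ a b i y) =ᶠ[nhds x]
      fun y => (∑ a, Wop Φ W a y * pd2 Φ a i y) - pd V i y := by
    filter_upwards [hΩ.mem_nhds hx] with y hy using sum_ihess_mul_pd3 hΩ hΦ hpos hW hMA hy i
  have hP := differentiableAt_ihess hΦ3 (hpos x hx)
  have hC (a b : Fin n) := differentiableAt_pd3 hΦ4 a b i
  have hWop (a : Fin n) := pd_comp_grad (Φ := Φ) (x := x) (W := pd W a)
    ((contDiffAt_pd (k := 2) hW.contDiffAt (by norm_num) a).differentiableAt (by norm_num))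
    (fun b => (contDiffAt_pd (k := 2) hΦ3 (by norm_num) b).differentiableAt (by norm_num)) k
  have hWd (a : Fin n) : DifferentiableAt ℝ (Wop Φ W a) x := (hWop a).1
  have hWp (a : Fin n) : pd (Wop Φ W a) k x
      = ∑ b, pd (pd W a) b (grad Φ x) * pd2 Φ b k x := (hWop a).2
  have hd := pd_congr hev k
  rw [pd_sub (DifferentiableAt.fun_sum fun a _ => (hWd a).fun_mul (differentiableAt_pd2 hΦ3 a i))
      ((contDiffAt_pd (k := 2) hVx (by norm_num) i).differentiableAt (by norm_num)),
    pd_sum_mul hWd (fun a => differentiableAt_pd2 hΦ3 a i),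
    pd_sum fun a _ => DifferentiableAt.fun_sum fun b _ => (hP a b).fun_mul (hC a b)] at hd
  simp only [pd_sum_mul (hP _) (hC _), hWp, pd_ihess hΦ3 (hpos x hx),
    Finset.sum_add_distrib] at hd
  have hcal : ∑ a, ∑ b, (-∑ c, ∑ d, ihess Φ x a c * pd3 Φ c d k x * ihess Φ x d b)
      * pd3 Φ a b i x = -calabi Φ i k x := by
    simp only [calabi, neg_mul, Finset.sum_neg_distrib, Finset.sum_mul]
    congr 1
    refine Finset.sum_congr rfl fun a _ => Finset.sum_congr rfl fun b _ =>
      Finset.sum_congr rfl fun c _ => Finset.sum_congr rfl fun d _ => ?_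
    rw [ihess_comm (hΦ3.of_le (by norm_num)) d b, pd3_comm_right hΦ3 a b i,
      pd3_comm_left (hΦ3.of_le (by norm_num)) a i b, pd3_comm_right hΦ3 c d k,
      pd3_comm_left (hΦ3.of_le (by norm_num)) c k d]
    ring
  have hhat : ∑ a, (∑ b, pd (pd W a) b (grad Φ x) * pd2 Φ b k x) * pd2 Φ a i x
      = What2 Φ W i k x := by
    simp only [What2, Finset.sum_mul]
    exact Finset.sum_congr rfl fun a _ => Finset.sum_congr rfl fun b _ => mul_right_comm _ _ _
  rw [hcal, hhat] at hd
  change _ + ∑ a, ∑ b, ihess Φ x a b * pd4 Φ a b i k x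
    = _ + (∑ a, Wop Φ W a x * pd3 Φ a i k x) - pd2 V i k x at hd
  linarith

/-- The contracted Christoffel symbols of the Hessian metric. -/
lemma sum_ihess_mul_Γh (hΩ : IsOpen Ω) (hΦ : ContDiffOn ℝ 5 Φ Ω)
    (hpos : ∀ x ∈ Ω, (hess Φ x).PosDef) (hW : ContDiff ℝ 3 W)
    (hMA : ∀ x ∈ Ω, Real.exp (-V x) = Real.exp (-W (grad Φ x)) * (hess Φ x).det)
    (hx : x ∈ Ω) (m : Fin n) :
    ∑ p, ∑ q, ihess Φ x p q * Γh Φ m p q x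
      = 1 / 2 * (Wop Φ W m x - ∑ k, ihess Φ x m k * pd V k x) := by
  have hΦx : ContDiffAt ℝ 3 Φ x := (hΦ.contDiffAt (hΩ.mem_nhds hx)).of_le (by norm_num)
  calc
    _ = 1 / 2 * ∑ k, ihess Φ x m k * ∑ p, ∑ q, ihess Φ x p q * pd3 Φ p q k x := by
      simp only [Γh, Finset.mul_sum]
      conv_rhs => rw [Finset.sum_comm]
      refine Finset.sum_congr rfl fun p _ => ?_
      conv_rhs => rw [Finset.sum_comm]
      refine Finset.sum_congr rfl fun q _ => Finset.sum_congr rfl fun k _ => ?_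
      rw [pd3_comm_left (hΦx.of_le (by norm_num)) k p q, pd3_comm_right hΦx p k q]
      ring
    _ = _ := by
      simp only [sum_ihess_mul_pd3 hΩ hΦ hpos hW hMA hx, mul_sub, Finset.sum_sub_distrib]
      congr 2
      simp only [Finset.mul_sum]
      rw [Finset.sum_comm]
      have h (a : Fin n) : ∑ k, ihess Φ x m k * (Wop Φ W a x * pd2 Φ a k x)
          = if m = a then Wop Φ W a x else 0 := by
        rw [← mul_boole, ← sum_ihess_mul_pd2 (hpos x hx) m a, Finset.mul_sum]
        refine Finset.sum_congr rfl fun k _ => ?_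
        rw [pd2_comm (hΦx.of_le (by norm_num)) a k]
        ring
      simp [h]

end MongeAmpere

/-- the weighted tensor Laplacian of the (0,1)-tensor `T_i = ∂_i f`. -/
theorem stmt_5 {n : ℕ} (Ω : Set (Fin n → ℝ)) (hΩ : IsOpen Ω)
    (Φ V W : (Fin n → ℝ) → ℝ)
    (hΦ : ContDiffOn ℝ 5 Φ Ω) (hΦconv : ConvexOn ℝ Ω Φ)
    (hpos : ∀ x ∈ Ω, (hess Φ x).PosDef)
    (hV : ContDiffOn ℝ 3 V Ω) (hW : ContDiff ℝ 3 W)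
    (hMA : ∀ x ∈ Ω, Real.exp (-V x) = Real.exp (-W (grad Φ x)) * (hess Φ x).det)
    (f : (Fin n → ℝ) → ℝ) (hf : ContDiffOn ℝ 3 f Ω) :
    ∀ x ∈ Ω, ∀ i : Fin n,
      LT1 Φ V W (fun i => pd f i) i x
      = (∑ m, ∑ k, ihess Φ x m k * pd3 f i m k x)
        - (∑ a, ∑ b, ∑ m, ∑ k,
            pd3 Φ i a b x * ihess Φ x a m * ihess Φ x b k * pd2 f m k x)
        - (∑ m, Wop Φ W m x * pd2 f m i x)
        + (1/2) * (∑ k, ∑ m, (pd2 V i k x - What2 Φ W i k x) * ihess Φ x k m * pd f m x)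
        + (1/4) * (∑ k, ∑ m, calabi Φ i k x * ihess Φ x k m * pd f m x) := by
  intro x hx i
  have hΦ4 : ContDiffAt ℝ 4 Φ x := (hΦ.contDiffAt (hΩ.mem_nhds hx)).of_le (by norm_num)
  have hΦ3 : ContDiffAt ℝ 3 Φ x := hΦ4.of_le (by norm_num)
  have hΦ2 : ContDiffAt ℝ 2 Φ x := hΦ4.of_le (by norm_num)
  have hf3 : ContDiffAt ℝ 3 f x := hf.contDiffAt (hΩ.mem_nhds hx)
  have hf2 : ContDiffAt ℝ 2 f x := hf3.of_le (by norm_num)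
  have hsecond : ∑ p, ∑ q, ihess Φ x p q * pd (covD1 Φ (fun i => pd f i) q i) p x
      = (∑ m, ∑ k, ihess Φ x m k * pd3 f i m k x)
        - 1 / 2 * ((∑ p, ∑ q, ihess Φ x p q * ∑ k, pd4 Φ k q i p x * metricGrad Φ f k x)
          + ∑ p, ∑ q, ihess Φ x p q * ∑ k, pd3 Φ k q i x * pd (metricGrad Φ f k) p x) := by
    simp only [pd_covD1_pd hΦ4 (hpos x hx) hf3, mul_sub, Finset.sum_sub_distrib,
      Finset.sum_add_distrib, mul_add, mul_left_comm _ (1 / 2 : ℝ), ← Finset.mul_sum]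
    congr 1
    exact Finset.sum_congr rfl fun p _ => Finset.sum_congr rfl fun q _ => by
      rw [pd3_comm_right hf3 i q p]
  have hfourth : ∑ p, ∑ q, ihess Φ x p q * ∑ k, pd4 Φ k q i p x * metricGrad Φ f k x
      = ∑ k, (What2 Φ W i k x + (∑ a, Wop Φ W a x * pd3 Φ a i k x) + calabi Φ i k x
          - pd2 V i k x) * metricGrad Φ f k x := by
    simp only [← sum_ihess_mul_pd4 hΩ hΦ hpos hV hW hMA hx, Finset.mul_sum, Finset.sum_mul]
    conv_rhs => rw [Finset.sum_comm]
    refine Finset.sum_congr rfl fun p _ => ?_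
    conv_rhs => rw [Finset.sum_comm]
    refine Finset.sum_congr rfl fun q _ => Finset.sum_congr rfl fun k _ => ?_
    rw [pd4_comm_right hΦ4 k q i p, pd4_comm_left hΦ2 k q p i, pd4_comm_middle hΦ3 q k p i,
      pd4_comm_left hΦ2 q p k i, pd4_comm_right hΦ4 p q k i]
    ring
  have hthird : ∑ p, ∑ q, ihess Φ x p q * ∑ k, pd3 Φ k q i x * pd (metricGrad Φ f k) p x
      = thirdContraction Φ (fun m k => pd2 f m k x) i x
        - ∑ k, calabi Φ i k x * metricGrad Φ f k x := by
    simp only [pd_metricGrad hΦ3 (hpos x hx) hf2]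
    rw [sum_ihess_pd3_mul hΦ3
        (fun d p => pd2 f d p x - ∑ c, pd3 Φ d c p x * metricGrad Φ f c x),
      thirdContraction_sub, ← thirdContraction_pd3]
    congr 2
    ext d p
    exact Finset.sum_congr rfl fun c _ => by rw [pd3_comm_left hΦ2 d c p]
  have hmixed : ∑ p, ∑ q, ihess Φ x p q
        * ∑ m, Γh Φ m p i x * covD1 Φ (fun i => pd f i) q m x
      = 1 / 2 * (thirdContraction Φ (fun m k => pd2 f m k x) i x
        - 1 / 2 * ∑ k, calabi Φ i k x * metricGrad Φ f k x) := by
    simp only [covD1_pd hΦ2]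
    rw [sum_ihess_Γh_mul hΦ3
        (fun m q => pd2 f m q x - 1 / 2 * ∑ k, pd3 Φ k q m x * metricGrad Φ f k x),
      thirdContraction_sub, thirdContraction_const_mul, ← thirdContraction_pd3]
    congr 4
    ext m q
    exact Finset.sum_congr rfl fun k _ => by rw [pd3_comm_right hΦ3 k q m]
  have htrace : ∑ p, ∑ q, ihess Φ x p q
        * ∑ m, Γh Φ m p q x * covD1 Φ (fun i => pd f i) m i x
      = 1 / 2 * ∑ m, (Wop Φ W m x - ∑ k, ihess Φ x m k * pd V k x)
        * covD1 Φ (fun i => pd f i) m i x := by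
    simp only [Finset.mul_sum, ← mul_assoc, ← sum_ihess_mul_Γh hΩ hΦ hpos hW hMA hx,
      Finset.sum_mul]
    conv_rhs => rw [Finset.sum_comm]
    exact Finset.sum_congr rfl fun p _ => Finset.sum_comm
  have hdrift : ∑ m, Wop Φ W m x * covD1 Φ (fun i => pd f i) m i x
      = (∑ m, Wop Φ W m x * pd2 f m i x)
        - 1 / 2 * ∑ k, (∑ a, Wop Φ W a x * pd3 Φ a i k x) * metricGrad Φ f k x := by
    simp only [covD1_pd hΦ2, mul_sub, Finset.sum_sub_distrib, Finset.mul_sum, Finset.sum_mul]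
    conv_rhs => rw [Finset.sum_comm]
    congr 1
    · exact Finset.sum_congr rfl fun m _ => by rw [pd2_comm hf2 i m]
    · refine Finset.sum_congr rfl fun m _ => Finset.sum_congr rfl fun k _ => ?_
      rw [pd3_comm_left hΦ2 k m i, pd3_comm_right hΦ3 m k i]
      ring
  have hgrad (A : Fin n → ℝ) : ∑ k, ∑ m, A k * ihess Φ x k m * pd f m x
      = ∑ k, A k * metricGrad Φ f k x := by
    simp only [metricGrad, Finset.mul_sum, mul_assoc]
  change _ = _ - thirdContraction Φ (fun m k => pd2 f m k x) i x - _ + _ + _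
  simp only [LT1, covD2, mul_sub, Finset.sum_sub_distrib]
  rw [hsecond, hfourth, hthird, hmixed, htrace, hgrad fun k => calabi Φ i k x,
    hgrad fun k => pd2 V i k x - What2 Φ W i k x]
  simp only [sub_mul, add_mul, Finset.sum_sub_distrib, Finset.sum_add_distrib, hdrift]
  ring
end
end

section
/- In the coordinate transport setting (with Φ of class C⁵, V and W of class C³), let T be the (0,3)-tensor with components T_{iab} = Φ_{iab}. Then the weighted tensor Laplacian of T satisfies, for every x ∈ Ω and all indices i, a, b: (LT)_{iab} = −V_{iab} + Ŵ_{iab} + ½ Σ_m [ (Σ_p Φ^{mp} V_{pi} + Σ_p W^{mp} Φ_{pi}) Φ_{mab} + (Σ_p Φ^{mp} V_{pa} + Σ_p W^{mp} Φ_{pa}) Φ_{mib} + (Σ_p Φ^{mp} V_{pb} + Σ_p W^{mp} Φ_{pb}) Φ_{mia} ] − ½ Σ Φ^{lp} Φ_{pik} Φ^{mq} Φ_{qal} Φ^{kr} Φ_{rbm} + ¼ Σ_{k,m} [ Φ^{km} g_{mi} Φ_{kab} + Φ^{km} g_{ma} Φ_{kib} + Φ^{km} g_{mb} Φ_{kia}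 ]. -/
noncomputable section
open scoped BigOperators
open Filter MeasureTheory

/-- `f` is differentiable at `x`, with the given value of its `p`-th partial derivative. -/
def HasPD {n : ℕ} (f : (Fin n → ℝ) → ℝ) (p : Fin n) (f' : ℝ) (x : Fin n → ℝ) : Prop :=
  DifferentiableAt ℝ f x ∧ pd f p x = f'

namespace HasPD

variable {n : ℕ} {f g : (Fin n → ℝ) → ℝ} {p : Fin n} {f' g' : ℝ} {x : Fin n → ℝ}

theorem congr_deriv (h : HasPD f p f' x) (e : f' = g') : HasPD f p g' x := e ▸ h

theorem unique (h : HasPD f p f' x) (h' : HasPD f p g' x) : f' = g' := h.2.symm.trans h'.2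

theorem congr_on {Ω : Set (Fin n → ℝ)} (h : HasPD f p f' x) (hΩ : IsOpen Ω) (hx : x ∈ Ω)
    (e : ∀ y ∈ Ω, g y = f y) : HasPD g p f' x := by
  have e' : g =ᶠ[nhds x] f := Filter.eventually_of_mem (hΩ.mem_nhds hx) e
  refine ⟨h.1.congr_of_eventuallyEq e', ?_⟩
  rw [← h.2, pd, pd, e'.fderiv_eq]

theorem const (c : ℝ) : HasPD (fun _ => c) p 0 x := by
  refine ⟨differentiableAt_const c, ?_⟩
  simp [pd]

theorem add (hf : HasPD f p f' x) (hg : HasPD g p g' x) :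
    HasPD (fun y => f y + g y) p (f' + g') x := by
  refine ⟨hf.1.add hg.1, ?_⟩
  rw [← hf.2, ← hg.2, pd, fderiv_fun_add hf.1 hg.1]
  rfl

theorem sub (hf : HasPD f p f' x) (hg : HasPD g p g' x) :
    HasPD (fun y => f y - g y) p (f' - g') x := by
  refine ⟨hf.1.sub hg.1, ?_⟩
  rw [← hf.2, ← hg.2, pd, fderiv_fun_sub hf.1 hg.1]
  rfl

theorem mul (hf : HasPD f p f' x) (hg : HasPD g p g' x) :
    HasPD (fun y => f y * g y) p (f' * g x + f x * g') x := by
  refine ⟨hf.1.mul hg.1, ?_⟩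
  rw [← hf.2, ← hg.2, pd, fderiv_fun_mul hf.1 hg.1]
  simp [pd]
  ring

theorem const_mul (c : ℝ) (hf : HasPD f p f' x) : HasPD (fun y => c * f y) p (c * f') x :=
  ((HasPD.const c).mul hf).congr_deriv (by ring)

theorem sum {ι : Type*} [Fintype ι] {F : ι → (Fin n → ℝ) → ℝ} {F' : ι → ℝ}
    (h : ∀ k, HasPD (F k) p (F' k) x) : HasPD (fun y => ∑ k, F k y) p (∑ k, F' k) x := by
  refine ⟨DifferentiableAt.fun_sum fun k _ => (h k).1, ?_⟩
  rw [pd, fderiv_fun_sum fun k _ => (h k).1, sum_apply]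
  exact Finset.sum_congr rfl fun k _ => (h k).2

theorem log (hf : HasPD f p f' x) (h0 : f x ≠ 0) :
    HasPD (fun y => Real.log (f y)) p (f' / f x) x := by
  refine ⟨hf.1.log h0, ?_⟩
  rw [← hf.2, pd, fderiv.log hf.1 h0]
  simp [pd, div_eq_inv_mul]

end HasPD

section PartialDerivatives

variable {n : ℕ} {Ω : Set (Fin n → ℝ)} {f g : (Fin n → ℝ) → ℝ} {x : Fin n → ℝ}

theorem hasPD_of_contDiffOn {k : WithTop ℕ∞} (hΩ : IsOpen Ω) (hf : ContDiffOn ℝ k f Ω)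
    (hk : k ≠ 0) (hx : x ∈ Ω) (p : Fin n) : HasPD f p (pd f p x) x :=
  ⟨(hf.contDiffAt (hΩ.mem_nhds hx)).differentiableAt hk, rfl⟩

theorem pd_congr_s7 (hΩ : IsOpen Ω) (e : ∀ y ∈ Ω, f y = g y) (hx : x ∈ Ω) (p : Fin n) :
    pd f p x = pd g p x := by
  have e' : f =ᶠ[nhds x] g := Filter.eventually_of_mem (hΩ.mem_nhds hx) e
  rw [pd, pd, e'.fderiv_eq]

theorem contDiffOn_pd {k m : WithTop ℕ∞} (hΩ : IsOpen Ω) (hf : ContDiffOn ℝ m f Ω)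
    (hkm : k + 1 ≤ m) (p : Fin n) : ContDiffOn ℝ k (pd f p) Ω :=
  (hf.fderiv_of_isOpen hΩ hkm).clm_apply contDiffOn_const

theorem pd2_comm_s7 {k : WithTop ℕ∞} (hΩ : IsOpen Ω) (hf : ContDiffOn ℝ k f Ω) (hk : 2 ≤ k)
    (hx : x ∈ Ω) (i j : Fin n) : pd (pd f i) j x = pd (pd f j) i x := by
  have hc := hf.contDiffAt (hΩ.mem_nhds hx)
  have hs := hc.isSymmSndFDerivAt (by simpa using hk)
  have hd : DifferentiableAt ℝ (fderiv ℝ f) x :=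
    (((hf.of_le hk).fderiv_of_isOpen hΩ (m := 1) (by norm_num)).contDiffAt
      (hΩ.mem_nhds hx)).differentiableAt one_ne_zero
  have key : ∀ i j : Fin n, pd (pd f i) j x
      = fderiv ℝ (fderiv ℝ f) x (Pi.single j 1) (Pi.single i 1) := by
    intro i j
    unfold pd
    rw [fderiv_clm_apply hd (differentiableAt_const _)]
    simp
  rw [key, key, hs]

theorem HasPD.comp_grad {G : (Fin n → ℝ) → ℝ} {k : WithTop ℕ∞} (hΩ : IsOpen Ω)
    (hf : ContDiffOn ℝ k f Ω) (hk : 2 ≤ k) (hx : x ∈ Ω)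
    (hG : DifferentiableAt ℝ G (grad f x)) (p : Fin n) :
    HasPD (fun y => G (grad f y)) p (∑ a, pd G a (grad f x) * pd2 f a p x) x := by
  have h1 : ∀ a, HasPD (pd f a) p (pd2 f a p x) x := fun a =>
    hasPD_of_contDiffOn hΩ (contDiffOn_pd hΩ (hf.of_le hk) (k := 1) (by norm_num) a)
      one_ne_zero hx p
  have hd : HasFDerivAt (grad f) (ContinuousLinearMap.pi fun a => fderiv ℝ (pd f a) x) x :=
    hasFDerivAt_pi.2 fun a => (h1 a).1.hasFDerivAt
  have hc := hG.hasFDerivAt.comp x hd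
  refine ⟨hc.differentiableAt, ?_⟩
  have e : fderiv ℝ (fun y => G (grad f y)) x = _ := hc.fderiv
  have hv : ∀ v : Fin n → ℝ, v = ∑ a, v a • (Pi.single a 1 : Fin n → ℝ) := fun v => by
    ext j
    simp [Finset.sum_apply, Pi.single_apply]
  rw [pd, e, ContinuousLinearMap.comp_apply,
    hv ((ContinuousLinearMap.pi fun a => fderiv ℝ (pd f a) x) (Pi.single p 1)), map_sum]
  refine Finset.sum_congr rfl fun a _ => ?_
  rw [map_smul, smul_eq_mul, mul_comm]
  rfl

theorem HasPD.det {A : (Fin n → ℝ) → Matrix (Fin n) (Fin n) ℝ} {A' : Matrix (Fin n) (Fin n) ℝ}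
    {p : Fin n} (h : ∀ i j, HasPD (fun y => A y i j) p (A' i j) x) :
    HasPD (fun y => (A y).det) p ((A x).adjugate * A').trace x := by
  let D : ContinuousMultilinearMap ℝ (fun _ : Fin n => Fin n → ℝ) ℝ :=
    ⟨(Matrix.detRowAlternating (R := ℝ) (n := Fin n)).toMultilinearMap,
      Continuous.matrix_det (A := fun M : Matrix (Fin n) (Fin n) ℝ => M) continuous_id⟩
  have hrow : ∀ i, HasFDerivAt (fun y => A y i)
      (ContinuousLinearMap.pi fun j => fderiv ℝ (fun y => A y i j) x) x := fun i =>
    hasFDerivAt_pi.2 fun j => (h i j).1.hasFDerivAt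
  have hc := HasFDerivAt.multilinear_comp (f := D) hrow
  refine ⟨hc.differentiableAt, ?_⟩
  have e : fderiv ℝ (fun y => (A y).det) x = _ := hc.fderiv
  rw [pd, e, sum_apply, Matrix.trace_mul_comm]
  refine Finset.sum_congr rfl fun i _ => ?_
  have e1 : ((ContinuousLinearMap.pi fun j => fderiv ℝ (fun y => A y i j) x) : _ →L[ℝ] _)
      (Pi.single p 1) = A' i := funext fun j => (h i j).2
  rw [ContinuousLinearMap.comp_apply, e1]
  change ((A x).updateRow i (A' i)).det = (A' * (A x).adjugate) i i
  rw [← Matrix.det_transpose, ← Matrix.updateCol_transpose, ← Matrix.cramer_apply,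
    Matrix.mul_apply, Matrix.cramer_eq_adjugate_mulVec, ← Matrix.adjugate_transpose, Matrix.mulVec,
    dotProduct]
  exact Finset.sum_congr rfl fun j _ => mul_comm _ _

/-- Entrywise partial derivative of a matrix-valued function. -/
def HasMPD (A : (Fin n → ℝ) → Matrix (Fin n) (Fin n) ℝ) (p : Fin n)
    (A' : Matrix (Fin n) (Fin n) ℝ) (x : Fin n → ℝ) : Prop :=
  ∀ i j, HasPD (fun y => A y i j) p (A' i j) x

variable {A B : (Fin n → ℝ) → Matrix (Fin n) (Fin n) ℝ} {A' B' : Matrix (Fin n) (Fin n) ℝ}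
  {p : Fin n}

theorem HasMPD.congr_deriv (h : HasMPD A p A' x) (e : A' = B') : HasMPD A p B' x := e ▸ h

theorem HasMPD.mul (hA : HasMPD A p A' x) (hB : HasMPD B p B' x) :
    HasMPD (fun y => A y * B y) p (A' * B x + A x * B') x := fun i j => by
  simp only [Matrix.mul_apply, Matrix.add_apply, ← Finset.sum_add_distrib]
  exact HasPD.sum fun k => (hA i k).mul (hB k j)

theorem HasMPD.sub (hA : HasMPD A p A' x) (hB : HasMPD B p B' x) :
    HasMPD (fun y => A y - B y) p (A' - B') x := fun i j => (hA i j).sub (hB i j)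

theorem HasMPD.trace (hA : HasMPD A p A' x) : HasPD (fun y => (A y).trace) p A'.trace x :=
  HasPD.sum fun i => hA i i

theorem HasMPD.differentiableAt_inv (hA : HasMPD A p A' x) (h0 : (A x).det ≠ 0) (i j : Fin n) :
    DifferentiableAt ℝ (fun y => (A y)⁻¹ i j) x := by
  have hd : DifferentiableAt ℝ (fun y => (A y).det) x := (HasPD.det hA).1
  have hadj : DifferentiableAt ℝ (fun y => (A y).adjugate i j) x := by
    simp only [Matrix.adjugate_apply]
    have hu : HasMPD (fun y => (A y).updateRow j (Pi.single i 1)) p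
        (A'.updateRow j 0) x := fun r s => by
      by_cases hr : r = j
      · subst hr
        simp only [Matrix.updateRow_self]
        exact HasPD.const _
      · simp only [Matrix.updateRow_ne hr]
        exact hA r s
    exact (HasPD.det hu).1
  simp only [Matrix.inv_def, Matrix.smul_apply, smul_eq_mul, Ring.inverse_eq_inv']
  exact (hd.inv h0).mul hadj

theorem HasMPD.inv (hΩ : IsOpen Ω) (hx : x ∈ Ω) (h0 : ∀ y ∈ Ω, (A y).det ≠ 0)
    (hA : HasMPD A p A' x) :
    HasMPD (fun y => (A y)⁻¹) p (-((A x)⁻¹ * A' * (A x)⁻¹)) x := by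
  have hI : HasMPD (fun y => (A y)⁻¹) p (Matrix.of fun i j => pd (fun y => (A y)⁻¹ i j) p x) x :=
    fun i j => ⟨hA.differentiableAt_inv (h0 x hx) i j, rfl⟩
  refine hI.congr_deriv ?_
  set X := Matrix.of fun i j => pd (fun y => (A y)⁻¹ i j) p x
  have hprod : X * A x + (A x)⁻¹ * A' = 0 := by
    ext i j
    refine (hI.mul hA i j).unique ((HasPD.const ((1 : Matrix (Fin n) (Fin n) ℝ) i j)).congr_on
      hΩ hx fun y hy => ?_)
    change ((A y)⁻¹ * A y) i j = _
    rw [Matrix.nonsing_inv_mul _ (h0 y hy).isUnit]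
  have hX : X * A x * (A x)⁻¹ = X :=
    Matrix.mul_nonsing_inv_cancel_right _ _ (h0 x hx).isUnit
  rw [← hX, eq_neg_of_add_eq_zero_left hprod, neg_mul]

end PartialDerivatives

section Symmetry

variable {n : ℕ} {Ω : Set (Fin n → ℝ)} {f : (Fin n → ℝ) → ℝ} {x : Fin n → ℝ}

theorem contDiffOn_pd2 {k m : WithTop ℕ∞} (hΩ : IsOpen Ω) (hf : ContDiffOn ℝ m f Ω)
    (hkm : k + 1 + 1 ≤ m) (i j : Fin n) : ContDiffOn ℝ k (pd2 f i j) Ω :=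
  contDiffOn_pd hΩ (contDiffOn_pd hΩ hf hkm i) le_rfl j

theorem contDiffOn_pd3 {k m : WithTop ℕ∞} (hΩ : IsOpen Ω) (hf : ContDiffOn ℝ m f Ω)
    (hkm : k + 1 + 1 + 1 ≤ m) (i j l : Fin n) : ContDiffOn ℝ k (pd3 f i j l) Ω :=
  contDiffOn_pd hΩ (contDiffOn_pd2 hΩ hf hkm i j) le_rfl l

theorem contDiffOn_pd4 {k m : WithTop ℕ∞} (hΩ : IsOpen Ω) (hf : ContDiffOn ℝ m f Ω)
    (hkm : k + 1 + 1 + 1 + 1 ≤ m) (i j l r : Fin n) : ContDiffOn ℝ k (pd4 f i j l r) Ω :=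
  contDiffOn_pd hΩ (contDiffOn_pd3 hΩ hf hkm i j l) le_rfl r

theorem pd3_swap_left {k : WithTop ℕ∞} (hΩ : IsOpen Ω) (hf : ContDiffOn ℝ k f Ω) (hk : 2 ≤ k)
    (hx : x ∈ Ω) (i j l : Fin n) : pd3 f i j l x = pd3 f j i l x :=
  pd_congr_s7 hΩ (fun _ hy => pd2_comm_s7 hΩ hf hk hy i j) hx l

theorem pd3_swap_right {k : WithTop ℕ∞} (hΩ : IsOpen Ω) (hf : ContDiffOn ℝ k f Ω) (hk : 3 ≤ k)
    (hx : x ∈ Ω) (i j l : Fin n) : pd3 f i j l x = pd3 f i l j x :=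
  pd2_comm_s7 hΩ (contDiffOn_pd hΩ (k := 2) hf (le_trans (by norm_num) hk) i) le_rfl hx j l

theorem pd4_swap_left {k : WithTop ℕ∞} (hΩ : IsOpen Ω) (hf : ContDiffOn ℝ k f Ω) (hk : 2 ≤ k)
    (hx : x ∈ Ω) (i j l r : Fin n) : pd4 f i j l r x = pd4 f j i l r x :=
  pd_congr_s7 hΩ (fun _ hy => pd3_swap_left hΩ hf hk hy i j l) hx r

theorem pd4_swap_mid {k : WithTop ℕ∞} (hΩ : IsOpen Ω) (hf : ContDiffOn ℝ k f Ω) (hk : 3 ≤ k)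
    (hx : x ∈ Ω) (i j l r : Fin n) : pd4 f i j l r x = pd4 f i l j r x :=
  pd_congr_s7 hΩ (fun _ hy => pd3_swap_right hΩ hf hk hy i j l) hx r

theorem pd4_swap_right {k : WithTop ℕ∞} (hΩ : IsOpen Ω) (hf : ContDiffOn ℝ k f Ω) (hk : 4 ≤ k)
    (hx : x ∈ Ω) (i j l r : Fin n) : pd4 f i j l r x = pd4 f i j r l x :=
  pd2_comm_s7 hΩ (contDiffOn_pd2 hΩ (k := 2) hf (le_trans (by norm_num) hk) i j) le_rfl hx l r

theorem pd5_swap_right {k : WithTop ℕ∞} (hΩ : IsOpen Ω) (hf : ContDiffOn ℝ k f Ω) (hk : 5 ≤ k)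
    (hx : x ∈ Ω) (i j l r s : Fin n) : pd5 f i j l r s x = pd5 f i j l s r x :=
  pd2_comm_s7 hΩ (contDiffOn_pd3 hΩ (k := 2) hf (le_trans (by norm_num) hk) i j l) le_rfl hx r s

/-- Moving the two leading indices of a fifth derivative to the end. -/
theorem pd5_rotate {k : WithTop ℕ∞} (hΩ : IsOpen Ω) (hf : ContDiffOn ℝ k f Ω) (hk : 5 ≤ k)
    (hx : x ∈ Ω) (p q i a b : Fin n) : pd5 f p q i a b x = pd5 f i a b q p x := by
  have h2 : (2 : WithTop ℕ∞) ≤ k := le_trans (by norm_num) hk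
  have h3 : (3 : WithTop ℕ∞) ≤ k := le_trans (by norm_num) hk
  have h4 : (4 : WithTop ℕ∞) ≤ k := le_trans (by norm_num) hk
  have e4 : ∀ y ∈ Ω, ∀ p q i a : Fin n, pd4 f p q i a y = pd4 f i a q p y := fun y hy p q i a => by
    rw [pd4_swap_mid hΩ hf h3 hy, pd4_swap_left hΩ hf h2 hy, pd4_swap_right hΩ hf h4 hy,
      pd4_swap_mid hΩ hf h3 hy, pd4_swap_right hΩ hf h4 hy]
  have c : pd5 f p q i a b x = pd5 f i a q p b x :=
    pd_congr_s7 hΩ (fun y hy => e4 y hy p q i a) hx b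
  have c' : pd5 f i a q b p x = pd5 f i a b q p x :=
    pd_congr_s7 hΩ (fun y hy => pd4_swap_right hΩ hf h4 hy i a q b) hx p
  rw [c, pd5_swap_right hΩ hf hk hx, c']

end Symmetry

/-- The matrix `(Φ_{rsi})_{rs}`. -/
def mat3 {n : ℕ} (Φ : (Fin n → ℝ) → ℝ) (i : Fin n) (x : Fin n → ℝ) : Matrix (Fin n) (Fin n) ℝ :=
  Matrix.of fun r s => pd3 Φ r s i x

/-- The matrix `(Φ_{rsij})_{rs}`. -/
def mat4 {n : ℕ} (Φ : (Fin n → ℝ) → ℝ) (i j : Fin n) (x : Fin n → ℝ) :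
    Matrix (Fin n) (Fin n) ℝ :=
  Matrix.of fun r s => pd4 Φ r s i j x

/-- The matrix `(Φ_{rsijk})_{rs}`. -/
def mat5 {n : ℕ} (Φ : (Fin n → ℝ) → ℝ) (i j k : Fin n) (x : Fin n → ℝ) :
    Matrix (Fin n) (Fin n) ℝ :=
  Matrix.of fun r s => pd5 Φ r s i j k x

section Transport

variable {n : ℕ} {Ω : Set (Fin n → ℝ)} {Φ V W : (Fin n → ℝ) → ℝ} {x : Fin n → ℝ}

theorem hasMPD_hess (hΩ : IsOpen Ω) (hΦ : ContDiffOn ℝ 5 Φ Ω) (hx : x ∈ Ω) (p : Fin n) :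
    HasMPD (hess Φ) p (mat3 Φ p x) x := fun r s =>
  hasPD_of_contDiffOn hΩ (contDiffOn_pd2 hΩ hΦ (k := 1) (by norm_num) r s) one_ne_zero hx p

theorem hasPD_pd3 (hΩ : IsOpen Ω) (hΦ : ContDiffOn ℝ 5 Φ Ω) (hx : x ∈ Ω) (i j k p : Fin n) :
    HasPD (pd3 Φ i j k) p (pd4 Φ i j k p x) x :=
  hasPD_of_contDiffOn hΩ (contDiffOn_pd3 hΩ hΦ (k := 1) (by norm_num) i j k) one_ne_zero hx p

theorem hasPD_pd4 (hΩ : IsOpen Ω) (hΦ : ContDiffOn ℝ 5 Φ Ω) (hx : x ∈ Ω) (i j k l p : Fin n) :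
    HasPD (pd4 Φ i j k l) p (pd5 Φ i j k l p x) x :=
  hasPD_of_contDiffOn hΩ (contDiffOn_pd4 hΩ hΦ (k := 1) (by norm_num) i j k l) one_ne_zero hx p

theorem hasMPD_mat3 (hΩ : IsOpen Ω) (hΦ : ContDiffOn ℝ 5 Φ Ω) (hx : x ∈ Ω) (i p : Fin n) :
    HasMPD (mat3 Φ i) p (mat4 Φ i p x) x := fun r s => hasPD_pd3 hΩ hΦ hx r s i p

theorem hasMPD_mat4 (hΩ : IsOpen Ω) (hΦ : ContDiffOn ℝ 5 Φ Ω) (hx : x ∈ Ω) (i j p : Fin n) :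
    HasMPD (mat4 Φ i j) p (mat5 Φ i j p x) x := fun r s => hasPD_pd4 hΩ hΦ hx r s i j p

theorem hasMPD_ihess (hΩ : IsOpen Ω) (hΦ : ContDiffOn ℝ 5 Φ Ω)
    (hpos : ∀ x ∈ Ω, (hess Φ x).PosDef) (hx : x ∈ Ω) (p : Fin n) :
    HasMPD (ihess Φ) p (-(ihess Φ x * mat3 Φ p x * ihess Φ x)) x :=
  (hasMPD_hess hΩ hΦ hx p).inv hΩ hx fun y hy => (hpos y hy).det_pos.ne'

theorem potential_eq (hpos : ∀ x ∈ Ω, (hess Φ x).PosDef)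
    (hMA : ∀ x ∈ Ω, Real.exp (-V x) = Real.exp (-W (grad Φ x)) * (hess Φ x).det) (hx : x ∈ Ω) :
    V x = W (grad Φ x) - Real.log (hess Φ x).det := by
  have h := congrArg Real.log (hMA x hx)
  rw [Real.log_mul (Real.exp_ne_zero _) (hpos x hx).det_pos.ne', Real.log_exp, Real.log_exp] at h
  linarith

theorem pd_potential (hΩ : IsOpen Ω) (hΦ : ContDiffOn ℝ 5 Φ Ω)
    (hpos : ∀ x ∈ Ω, (hess Φ x).PosDef) (hW : ContDiff ℝ 3 W)
    (hMA : ∀ x ∈ Ω, Real.exp (-V x) = Real.exp (-W (grad Φ x)) * (hess Φ x).det) (hx : x ∈ Ω)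
    (i : Fin n) :
    pd V i x = (∑ c, pd W c (grad Φ x) * pd2 Φ c i x) - (ihess Φ x * mat3 Φ i x).trace := by
  have hdet := (hpos x hx).det_pos.ne'
  have h1 : HasPD (fun y => W (grad Φ y)) i _ x :=
    HasPD.comp_grad hΩ hΦ (by norm_num) hx (hW.differentiable (by norm_num) _) i
  have h2 := (HasPD.det (hasMPD_hess hΩ hΦ hx i)).log hdet
  have h := ((h1.sub h2).congr_on hΩ hx fun y hy => potential_eq hpos hMA hy).2
  rw [h, ihess, Matrix.inv_def, Ring.inverse_eq_inv', Matrix.smul_mul, Matrix.trace_smul,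
    smul_eq_mul, div_eq_inv_mul]

theorem pd2_potential (hΩ : IsOpen Ω) (hΦ : ContDiffOn ℝ 5 Φ Ω)
    (hpos : ∀ x ∈ Ω, (hess Φ x).PosDef) (hW : ContDiff ℝ 3 W)
    (hMA : ∀ x ∈ Ω, Real.exp (-V x) = Real.exp (-W (grad Φ x)) * (hess Φ x).det) (hx : x ∈ Ω)
    (i j : Fin n) :
    pd2 V i j x = (∑ c, ((∑ d, pd2 W c d (grad Φ x) * pd2 Φ d j x) * pd2 Φ c i x
        + pd W c (grad Φ x) * pd3 Φ c i j x))
      - (ihess Φ x * mat4 Φ i j x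
        - ihess Φ x * mat3 Φ j x * ihess Φ x * mat3 Φ i x).trace := by
  have hW1 : ∀ c, ContDiffOn ℝ 1 (pd W c) Set.univ := fun c =>
    contDiffOn_pd isOpen_univ hW.contDiffOn (by norm_num) c
  have h1 : HasPD (fun y => ∑ c, pd W c (grad Φ y) * pd2 Φ c i y) j _ x := HasPD.sum fun c =>
    (HasPD.comp_grad hΩ hΦ (by norm_num) hx
      (((hW1 c).contDiffAt Filter.univ_mem).differentiableAt one_ne_zero) j).mul
      (hasMPD_hess hΩ hΦ hx j c i)
  have h2 := ((hasMPD_ihess hΩ hΦ hpos hx j).mul (hasMPD_mat3 hΩ hΦ hx i j)).trace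
  have h := ((h1.sub h2).congr_on hΩ hx fun y hy => pd_potential hΩ hΦ hpos hW hMA hy i).2
  rw [neg_mul, neg_add_eq_sub] at h
  exact h

theorem pd3_potential (hΩ : IsOpen Ω) (hΦ : ContDiffOn ℝ 5 Φ Ω)
    (hpos : ∀ x ∈ Ω, (hess Φ x).PosDef) (hW : ContDiff ℝ 3 W)
    (hMA : ∀ x ∈ Ω, Real.exp (-V x) = Real.exp (-W (grad Φ x)) * (hess Φ x).det) (hx : x ∈ Ω)
    (i j k : Fin n) :
    pd3 V i j k x
      = (∑ c, ((∑ d, ((∑ e, pd3 W c d e (grad Φ x) * pd2 Φ e k x) * pd2 Φ d j x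
            + pd2 W c d (grad Φ x) * pd3 Φ d j k x)) * pd2 Φ c i x
          + (∑ d, pd2 W c d (grad Φ x) * pd2 Φ d j x) * pd3 Φ c i k x
          + ((∑ d, pd2 W c d (grad Φ x) * pd2 Φ d k x) * pd3 Φ c i j x
            + pd W c (grad Φ x) * pd4 Φ c i j k x)))
        - ((ihess Φ x * mat5 Φ i j k x).trace
          - (ihess Φ x * mat3 Φ k x * ihess Φ x * mat4 Φ i j x).trace
          - (ihess Φ x * mat3 Φ i x * ihess Φ x * mat4 Φ j k x).trace
          - (ihess Φ x * mat3 Φ j x * ihess Φ x * mat4 Φ i k x).trace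
          + (ihess Φ x * mat3 Φ i x * ihess Φ x * mat3 Φ k x * ihess Φ x * mat3 Φ j x).trace
          + (ihess Φ x * mat3 Φ i x * ihess Φ x * mat3 Φ j x * ihess Φ x * mat3 Φ k x).trace) := by
  have hW1 : ∀ c, ContDiffOn ℝ 1 (pd W c) Set.univ := fun c =>
    contDiffOn_pd isOpen_univ hW.contDiffOn (by norm_num) c
  have hW2 : ∀ c d, ContDiffOn ℝ 1 (pd2 W c d) Set.univ := fun c d =>
    contDiffOn_pd2 isOpen_univ hW.contDiffOn (by norm_num) c d
  have hcomp1 := fun c => HasPD.comp_grad hΩ hΦ (by norm_num) hx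
      (((hW1 c).contDiffAt Filter.univ_mem).differentiableAt one_ne_zero) k
  have hcomp2 := fun c d => HasPD.comp_grad hΩ hΦ (by norm_num) hx
      (((hW2 c d).contDiffAt Filter.univ_mem).differentiableAt one_ne_zero) k
  have h1 : HasPD (fun y => ∑ c, ((∑ d, pd2 W c d (grad Φ y) * pd2 Φ d j y) * pd2 Φ c i y
        + pd W c (grad Φ y) * pd3 Φ c i j y)) k _ x := HasPD.sum fun c =>
    ((HasPD.sum fun d => (hcomp2 c d).mul (hasMPD_hess hΩ hΦ hx k d j)).mul
      (hasMPD_hess hΩ hΦ hx k c i)).add ((hcomp1 c).mul (hasPD_pd3 hΩ hΦ hx c i j k))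
  have hP := hasMPD_ihess hΩ hΦ hpos hx k
  have h2 := ((hP.mul (hasMPD_mat4 hΩ hΦ hx i j k)).sub
    (((hP.mul (hasMPD_mat3 hΩ hΦ hx j k)).mul hP).mul (hasMPD_mat3 hΩ hΦ hx i k))).trace
  have h : pd3 V i j k x = _ :=
    ((h1.sub h2).congr_on hΩ hx fun y hy => pd2_potential hΩ hΦ hpos hW hMA hy i j).2
  rw [h]
  congr 1
  simp only [Matrix.trace_sub, Matrix.trace_add, add_mul, neg_mul, mul_neg, Matrix.trace_neg,
    ← Matrix.mul_assoc]
  have c1 := Matrix.trace_mul_comm (ihess Φ x * mat4 Φ j k x) (ihess Φ x * mat3 Φ i x)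
  have c2 := Matrix.trace_mul_comm (ihess Φ x * mat3 Φ k x * ihess Φ x * mat3 Φ j x)
    (ihess Φ x * mat3 Φ i x)
  have c3 := Matrix.trace_mul_comm (ihess Φ x * mat3 Φ j x * ihess Φ x * mat3 Φ k x)
    (ihess Φ x * mat3 Φ i x)
  simp only [← Matrix.mul_assoc] at c1 c2 c3
  linarith

end Transport

section Contractions

variable {n : ℕ}

theorem sum_flat4 (G : Fin n → Fin n → Fin n → Fin n → ℝ) :
    ∑ a, ∑ b, ∑ c, ∑ d, G a b c d
      = ∑ t : Fin n × Fin n × Fin n × Fin n, G t.1 t.2.1 t.2.2.1 t.2.2.2 := by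
  simp only [Fintype.sum_prod_type]

theorem sum_flat6 (G : Fin n → Fin n → Fin n → Fin n → Fin n → Fin n → ℝ) :
    ∑ a, ∑ b, ∑ c, ∑ d, ∑ e, ∑ f, G a b c d e f
      = ∑ t : Fin n × Fin n × Fin n × Fin n × Fin n × Fin n,
        G t.1 t.2.1 t.2.2.1 t.2.2.2.1 t.2.2.2.2.1 t.2.2.2.2.2 := by
  simp only [Fintype.sum_prod_type]

variable (P : Matrix (Fin n) (Fin n) ℝ) (T : Fin n → Fin n → Fin n → ℝ)
  (Q : Fin n → Fin n → Fin n → Fin n → ℝ)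

/-- The matrix of a three-index array with its last index fixed. -/
def slice3 (i : Fin n) : Matrix (Fin n) (Fin n) ℝ := Matrix.of fun r s => T r s i

/-- The matrix of a four-index array with its last two indices fixed. -/
def slice4 (i j : Fin n) : Matrix (Fin n) (Fin n) ℝ := Matrix.of fun r s => Q r s i j

theorem contract_dInv (hP : ∀ r s, P r s = P s r) (hT₁ : ∀ r s t, T r s t = T s r t)
    (hT₂ : ∀ r s t, T r s t = T r t s) (i a b : Fin n) :
    ∑ p, ∑ q, ∑ m, ∑ k, P p q * ((P * slice3 T p * P) m k * T k q i * T m a b)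
      = ∑ k, ∑ m, P k m * (P * slice3 T m * P * slice3 T i).trace * T k a b := by
  simp only [slice3, Matrix.trace, Matrix.diag_apply, Matrix.mul_apply, Matrix.of_apply,
    Finset.mul_sum, Finset.sum_mul]
  rw [sum_flat6, sum_flat6]
  refine Fintype.sum_equiv ⟨fun ⟨p, q, m, k, s, r⟩ => (m, r, q, k, s, p),
    fun ⟨m, r, q, k, s, p⟩ => (p, q, m, k, s, r),
    fun _ => rfl, fun _ => rfl⟩ _ _ ?_
  rintro ⟨p, q, m, k, s, r⟩
  simp only [Equiv.coe_fn_mk, hP, hT₁, hT₂]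
  ring

theorem contract_fourth (hP : ∀ r s, P r s = P s r)
    (hQ₁ : ∀ r s t u, Q r s t u = Q s r t u)
    (hQ₂ : ∀ r s t u, Q r s t u = Q r t s u)
    (hQ₃ : ∀ r s t u, Q r s t u = Q r s u t) (i a b : Fin n) :
    ∑ p, ∑ q, ∑ m, ∑ k, P p q * (P m k * Q k q i p * T m a b)
      = ∑ k, ∑ m, P k m * (P * slice4 Q m i).trace * T k a b := by
  simp only [slice4, Matrix.trace, Matrix.diag_apply, Matrix.mul_apply, Matrix.of_apply,
    Finset.mul_sum, Finset.sum_mul]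
  rw [sum_flat4, sum_flat4]
  refine Fintype.sum_equiv ⟨fun ⟨p, q, m, k⟩ => (m, k, q, p),
    fun ⟨m, k, q, p⟩ => (p, q, m, k),
    fun _ => rfl, fun _ => rfl⟩ _ _ ?_
  rintro ⟨p, q, m, k⟩
  simp only [Equiv.coe_fn_mk, hP, hQ₁, hQ₂, hQ₃]
  ring

theorem contract_third_fourth (hP : ∀ r s, P r s = P s r) (hT₁ : ∀ r s t, T r s t = T s r t)
    (hT₂ : ∀ r s t, T r s t = T r t s)
    (hQ₁ : ∀ r s t u, Q r s t u = Q s r t u)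
    (hQ₂ : ∀ r s t u, Q r s t u = Q r t s u)
    (hQ₃ : ∀ r s t u, Q r s t u = Q r s u t) (i a b : Fin n) :
    ∑ p, ∑ q, ∑ m, ∑ k, P p q * (P m k * T k q i * Q m a b p)
      = (P * slice3 T i * P * slice4 Q a b).trace := by
  simp only [slice3, slice4, Matrix.trace, Matrix.diag_apply, Matrix.mul_apply, Matrix.of_apply,
    Finset.sum_mul]
  rw [sum_flat4, sum_flat4]
  refine Fintype.sum_equiv ⟨fun ⟨p, q, m, k⟩ => (p, m, k, q),
    fun ⟨p, m, k, q⟩ => (p, q, m, k),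
    fun _ => rfl, fun _ => rfl⟩ _ _ ?_
  rintro ⟨p, q, m, k⟩
  simp only [Equiv.coe_fn_mk, hP, hT₁, hT₂, hQ₁, hQ₂, hQ₃]
  ring

theorem contract_third_pair (hT₁ : ∀ r s t, T r s t = T s r t)
    (hT₂ : ∀ r s t, T r s t = T r t s) (i a b : Fin n) :
    ∑ p, ∑ q, ∑ m, ∑ k, ∑ l, ∑ r, P p q * (P m k * T k p i) * (P l r * T r q m * T l a b)
      = ∑ k, ∑ m, P k m * (P * slice3 T m * P * slice3 T i).trace * T k a b := by
  simp only [slice3, Matrix.trace, Matrix.diag_apply, Matrix.mul_apply, Matrix.of_apply,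
    Finset.mul_sum, Finset.sum_mul]
  rw [sum_flat6, sum_flat6]
  refine Fintype.sum_equiv ⟨fun ⟨p, q, m, k, l, r⟩ => (l, r, p, k, m, q),
    fun ⟨l, r, p, k, m, q⟩ => (p, q, m, k, l, r),
    fun _ => rfl, fun _ => rfl⟩ _ _ ?_
  rintro ⟨p, q, m, k, l, r⟩
  simp only [Equiv.coe_fn_mk, hT₁, hT₂]
  ring

theorem contract_third_cycle (hP : ∀ r s, P r s = P s r) (hT₁ : ∀ r s t, T r s t = T s r t)
    (hT₂ : ∀ r s t, T r s t = T r t s) (i a b : Fin n) :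
    ∑ p, ∑ q, ∑ m, ∑ k, ∑ l, ∑ r, P p q * (P m k * T k p i) * (P l r * T r q a * T l m b)
      = (P * slice3 T i * P * slice3 T a * P * slice3 T b).trace := by
  simp only [slice3, Matrix.trace, Matrix.diag_apply, Matrix.mul_apply, Matrix.of_apply,
    Finset.sum_mul]
  rw [sum_flat6, sum_flat6]
  refine Fintype.sum_equiv ⟨fun ⟨p, q, m, k, l, r⟩ => (m, l, r, q, p, k),
    fun ⟨m, l, r, q, p, k⟩ => (p, q, m, k, l, r),
    fun _ => rfl, fun _ => rfl⟩ _ _ ?_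
  rintro ⟨p, q, m, k, l, r⟩
  simp only [Equiv.coe_fn_mk, hP, hT₁, hT₂]
  ring

theorem cycle_sum_eq_trace (hT₁ : ∀ r s t, T r s t = T s r t)
    (hT₂ : ∀ r s t, T r s t = T r t s) (i a b : Fin n) :
    ∑ l, ∑ p, ∑ m, ∑ q, ∑ k, ∑ r, P l p * T p i k * P m q * T q a l * P k r * T r b m
      = (P * slice3 T i * P * slice3 T b * P * slice3 T a).trace := by
  simp only [slice3, Matrix.trace, Matrix.diag_apply, Matrix.mul_apply, Matrix.of_apply,
    Finset.sum_mul]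
  rw [sum_flat6, sum_flat6]
  refine Fintype.sum_equiv ⟨fun ⟨l, p, m, q, k, r⟩ => (l, q, m, r, k, p),
    fun ⟨l, q, m, r, k, p⟩ => (l, p, m, q, k, r),
    fun _ => rfl, fun _ => rfl⟩ _ _ ?_
  rintro ⟨l, p, m, q, k, r⟩
  simp only [Equiv.coe_fn_mk, hT₁, hT₂]
  ring

theorem pair_sum_eq_trace (hP : ∀ r s, P r s = P s r) (hT₁ : ∀ r s t, T r s t = T s r t)
    (hT₂ : ∀ r s t, T r s t = T r t s) (i j : Fin n) :
    ∑ a, ∑ b, ∑ c, ∑ d, T i a b * T j c d * P a c * P b d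
      = (P * slice3 T i * P * slice3 T j).trace := by
  simp only [slice3, Matrix.trace, Matrix.diag_apply, Matrix.mul_apply, Matrix.of_apply,
    Finset.sum_mul]
  rw [sum_flat4, sum_flat4]
  refine Fintype.sum_equiv ⟨fun ⟨a, b, c, d⟩ => (c, d, b, a),
    fun ⟨c, d, b, a⟩ => (a, b, c, d),
    fun _ => rfl, fun _ => rfl⟩ _ _ ?_
  rintro ⟨a, b, c, d⟩
  simp only [Equiv.coe_fn_mk, hP, hT₁, hT₂]
  ring

theorem contract_christoffel (hT₁ : ∀ r s t, T r s t = T s r t)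
    (hT₂ : ∀ r s t, T r s t = T r t s) (X : Fin n → ℝ) :
    ∑ p, ∑ q, ∑ m, ∑ k, P p q * (P m k * T k p q * X m)
      = ∑ m, ∑ k, P m k * (P * slice3 T k).trace * X m := by
  simp only [slice3, Matrix.trace, Matrix.diag_apply, Matrix.mul_apply, Matrix.of_apply,
    Finset.mul_sum, Finset.sum_mul]
  rw [sum_flat4, sum_flat4]
  refine Fintype.sum_equiv ⟨fun ⟨p, q, m, k⟩ => (m, k, p, q),
    fun ⟨m, k, p, q⟩ => (p, q, m, k),
    fun _ => rfl, fun _ => rfl⟩ _ _ ?_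
  rintro ⟨p, q, m, k⟩
  simp only [Equiv.coe_fn_mk, hT₁, hT₂]
  ring

theorem trace_cycle_swap (hP : ∀ r s, P r s = P s r) (hT₁ : ∀ r s t, T r s t = T s r t)
    (i a b : Fin n) :
    (P * slice3 T i * P * slice3 T b * P * slice3 T a).trace
      = (P * slice3 T i * P * slice3 T a * P * slice3 T b).trace := by
  have hPt : P.transpose = P := Matrix.ext fun r s => hP s r
  have hMt : ∀ i, (slice3 T i).transpose = slice3 T i := fun i => Matrix.ext fun r s => hT₁ s r i
  rw [← Matrix.trace_transpose]
  simp only [Matrix.transpose_mul, hPt, hMt]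
  rw [← Matrix.mul_assoc, Matrix.trace_mul_comm (slice3 T a * P)]
  simp only [← Matrix.mul_assoc]
  rw [Matrix.trace_mul_comm _ (slice3 T b)]
  simp only [← Matrix.mul_assoc]

/-- The contracted derivative of a Christoffel correction term. -/
theorem contract_deriv_correction (hP : ∀ r s, P r s = P s r) (hT₁ : ∀ r s t, T r s t = T s r t)
    (hT₂ : ∀ r s t, T r s t = T r t s)
    (hQ₁ : ∀ r s t u, Q r s t u = Q s r t u)
    (hQ₂ : ∀ r s t u, Q r s t u = Q r t s u)
    (hQ₃ : ∀ r s t u, Q r s t u = Q r s u t) (i a b : Fin n) :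
    ∑ p, ∑ q, P p q * ∑ m, (((1 / 2) * ∑ k, ((-(P * slice3 T p * P)) m k * T k q i
        + P m k * Q k q i p)) * T m a b + ((1 / 2) * ∑ k, P m k * T k q i) * Q m a b p)
      = -(1 / 2) * (∑ k, ∑ m, P k m * (P * slice3 T m * P * slice3 T i).trace * T k a b)
        + (1 / 2) * (∑ k, ∑ m, P k m * (P * slice4 Q m i).trace * T k a b)
        + (1 / 2) * (P * slice3 T i * P * slice4 Q a b).trace := by
  rw [← contract_dInv P T hP hT₁ hT₂, ← contract_fourth P T Q hP hQ₁ hQ₂ hQ₃,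
    ← contract_third_fourth P T Q hP hT₁ hT₂ hQ₁ hQ₂ hQ₃]
  simp only [Finset.mul_sum, Finset.sum_mul, ← Finset.sum_add_distrib, Matrix.neg_apply]
  refine Finset.sum_congr rfl fun p _ => Finset.sum_congr rfl fun q _ =>
    Finset.sum_congr rfl fun m _ => Finset.sum_congr rfl fun k _ => ?_
  ring

/-- The contracted Christoffel correction of a corrected fourth-order array. -/
theorem contract_correction (hP : ∀ r s, P r s = P s r) (hT₁ : ∀ r s t, T r s t = T s r t)
    (hT₂ : ∀ r s t, T r s t = T r t s)
    (hQ₁ : ∀ r s t u, Q r s t u = Q s r t u)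
    (hQ₂ : ∀ r s t u, Q r s t u = Q r t s u)
    (hQ₃ : ∀ r s t u, Q r s t u = Q r s u t) (i a b : Fin n) :
    ∑ p, ∑ q, P p q * ∑ m, ((1 / 2) * ∑ k, P m k * T k p i) * (Q m a b q
        - (∑ l, ((1 / 2) * ∑ r, P l r * T r q m) * T l a b)
        - (∑ l, ((1 / 2) * ∑ r, P l r * T r q a) * T l m b)
        - (∑ l, ((1 / 2) * ∑ r, P l r * T r q b) * T l m a))
      = (1 / 2) * (P * slice3 T i * P * slice4 Q a b).trace
        - (1 / 4) * (∑ k, ∑ m, P k m * (P * slice3 T m * P * slice3 T i).trace * T k a b)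
        - (1 / 2) * (P * slice3 T i * P * slice3 T a * P * slice3 T b).trace := by
  have h1 := contract_third_fourth P T Q hP hT₁ hT₂ hQ₁ hQ₂ hQ₃ i a b
  have h2 := contract_third_pair P T hT₁ hT₂ i a b
  have h3 := contract_third_cycle P T hP hT₁ hT₂ i a b
  have h4 := (contract_third_cycle P T hP hT₁ hT₂ i b a).trans
    (trace_cycle_swap P T hP hT₁ i a b)
  have e1 : ∑ p, ∑ q, ∑ m, ∑ k, P p q * (P m k * T k q i * Q m a b p)
      = ∑ p, ∑ q, ∑ m, ∑ k, P p q * (P m k * T k p i * Q m a b q) := by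
    rw [Finset.sum_comm]
    simp only [hP]
  rw [e1] at h1
  have key : (1 / 2) * (P * slice3 T i * P * slice4 Q a b).trace
        - (1 / 4) * (∑ k, ∑ m, P k m * (P * slice3 T m * P * slice3 T i).trace * T k a b)
        - (1 / 2) * (P * slice3 T i * P * slice3 T a * P * slice3 T b).trace
      = (1 / 2) * (P * slice3 T i * P * slice4 Q a b).trace
        - (1 / 4) * (∑ k, ∑ m, P k m * (P * slice3 T m * P * slice3 T i).trace * T k a b)
        - (1 / 4) * (P * slice3 T i * P * slice3 T a * P * slice3 T b).trace
        - (1 / 4) * (P * slice3 T i * P * slice3 T a * P * slice3 T b).trace := by ring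
  rw [key]
  nth_rewrite 2 [← h4]
  rw [← h1, ← h2, ← h3]
  have factor : ∀ (c : ℝ) (u : Fin n → ℝ) (v : Fin n → Fin n → ℝ),
      ∑ k, ∑ l, ∑ r, c * u k * v l r = c * (∑ k, u k) * ∑ l, ∑ r, v l r := fun c u v => by
    rw [Finset.mul_sum Finset.univ u c, Finset.sum_mul]
    simp only [Finset.mul_sum]
  have half : ∀ (u : Fin n → Fin n → ℝ) (v : Fin n → ℝ),
      ∑ l, ((1 / 2) * ∑ r, u l r) * v l = (1 / 2) * ∑ l, ∑ r, u l r * v l := fun u v => by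
    simp only [Finset.mul_sum, Finset.sum_mul, mul_assoc]
  simp only [factor]
  rw [Finset.mul_sum, Finset.mul_sum, Finset.mul_sum, Finset.mul_sum, ← Finset.sum_sub_distrib,
    ← Finset.sum_sub_distrib, ← Finset.sum_sub_distrib]
  refine Finset.sum_congr rfl fun p _ => ?_
  rw [Finset.mul_sum, Finset.mul_sum, Finset.mul_sum, Finset.mul_sum, ← Finset.sum_sub_distrib,
    ← Finset.sum_sub_distrib, ← Finset.sum_sub_distrib]
  refine Finset.sum_congr rfl fun q _ => ?_
  rw [Finset.mul_sum, Finset.mul_sum, Finset.mul_sum, Finset.mul_sum, Finset.mul_sum,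
    ← Finset.sum_sub_distrib, ← Finset.sum_sub_distrib, ← Finset.sum_sub_distrib]
  refine Finset.sum_congr rfl fun m _ => ?_
  rw [← Finset.mul_sum, ← Finset.sum_mul]
  simp only [half]
  ring

end Contractions

section Laplacian

variable {n : ℕ} {Ω : Set (Fin n → ℝ)} {Φ V W : (Fin n → ℝ) → ℝ} {x : Fin n → ℝ}

/-- The covariant derivative of `Φ_{iab}`, with the correction terms brought to a common form. -/
def nablaThird {n : ℕ} (Φ : (Fin n → ℝ) → ℝ) (q i a b : Fin n) (x : Fin n → ℝ) : ℝ :=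
  pd4 Φ i a b q x - ∑ m, Γh Φ m q i x * pd3 Φ m a b x - ∑ m, Γh Φ m q a x * pd3 Φ m i b x
    - ∑ m, Γh Φ m q b x * pd3 Φ m i a x

theorem covD3_eq_nablaThird (hΩ : IsOpen Ω) (hΦ : ContDiffOn ℝ 5 Φ Ω) (hx : x ∈ Ω)
    (q i a b : Fin n) :
    covD3 Φ (fun i a b => pd3 Φ i a b) q i a b x = nablaThird Φ q i a b x := by
  have h1 : ∀ m, pd3 Φ i m b x = pd3 Φ m i b x := fun m =>
    pd3_swap_left hΩ hΦ (by norm_num) hx i m b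
  have h2 : ∀ m, pd3 Φ i a m x = pd3 Φ m i a x := fun m => by
    rw [pd3_swap_right hΩ hΦ (by norm_num) hx, pd3_swap_left hΩ hΦ (by norm_num) hx]
  simp only [covD3, nablaThird, h1, h2]
  rfl

theorem nablaThird_swap_left (hΩ : IsOpen Ω) (hΦ : ContDiffOn ℝ 5 Φ Ω) (hx : x ∈ Ω)
    (q i a b : Fin n) : nablaThird Φ q i a b x = nablaThird Φ q a i b x := by
  have h1 : ∀ m, pd3 Φ m a i x = pd3 Φ m i a x := fun m =>
    pd3_swap_right hΩ hΦ (by norm_num) hx m a i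
  simp only [nablaThird, h1, pd4_swap_left hΩ hΦ (by norm_num) hx i a]
  ring

theorem nablaThird_swap_right (hΩ : IsOpen Ω) (hΦ : ContDiffOn ℝ 5 Φ Ω) (hx : x ∈ Ω)
    (q i a b : Fin n) : nablaThird Φ q i a b x = nablaThird Φ q i b a x := by
  have h1 : ∀ m, pd3 Φ m b a x = pd3 Φ m a b x := fun m =>
    pd3_swap_right hΩ hΦ (by norm_num) hx m b a
  simp only [nablaThird, h1, pd4_swap_mid hΩ hΦ (by norm_num) hx i a]
  ring

/-- The partial derivative of the correction term `Σ_m Γ^m_{qi} Φ_{mab}`. -/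
def dCorrection {n : ℕ} (Φ : (Fin n → ℝ) → ℝ) (p q i a b : Fin n) (x : Fin n → ℝ) : ℝ :=
  ∑ m, (((1 / 2) * ∑ k, ((-(ihess Φ x * mat3 Φ p x * ihess Φ x)) m k * pd3 Φ k q i x
      + ihess Φ x m k * pd4 Φ k q i p x)) * pd3 Φ m a b x
    + ((1 / 2) * ∑ k, ihess Φ x m k * pd3 Φ k q i x) * pd4 Φ m a b p x)

theorem hasPD_correction (hΩ : IsOpen Ω) (hΦ : ContDiffOn ℝ 5 Φ Ω)
    (hpos : ∀ x ∈ Ω, (hess Φ x).PosDef) (hx : x ∈ Ω) (p q i a b : Fin n) :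
    HasPD (fun y => ∑ m, Γh Φ m q i y * pd3 Φ m a b y) p (dCorrection Φ p q i a b x) x :=
  HasPD.sum fun m => ((HasPD.sum fun k => (hasMPD_ihess hΩ hΦ hpos hx p m k).mul
    (hasPD_pd3 hΩ hΦ hx k q i p)).const_mul (1 / 2)).mul (hasPD_pd3 hΩ hΦ hx m a b p)

theorem pd_covD3 (hΩ : IsOpen Ω) (hΦ : ContDiffOn ℝ 5 Φ Ω)
    (hpos : ∀ x ∈ Ω, (hess Φ x).PosDef) (hx : x ∈ Ω) (p q i a b : Fin n) :
    pd (covD3 Φ (fun i a b => pd3 Φ i a b) q i a b) p x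
      = pd5 Φ i a b q p x - dCorrection Φ p q i a b x - dCorrection Φ p q a i b x
        - dCorrection Φ p q b i a x :=
  (((((hasPD_pd4 hΩ hΦ hx i a b q p).sub (hasPD_correction hΩ hΦ hpos hx p q i a b)).sub
    (hasPD_correction hΩ hΦ hpos hx p q a i b)).sub
    (hasPD_correction hΩ hΦ hpos hx p q b i a)).congr_on hΩ hx
      fun _ hy => covD3_eq_nablaThird hΩ hΦ hy q i a b).2

theorem covD4_covD3 (hΩ : IsOpen Ω) (hΦ : ContDiffOn ℝ 5 Φ Ω)
    (hpos : ∀ x ∈ Ω, (hess Φ x).PosDef) (hx : x ∈ Ω) (p q i a b : Fin n) :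
    covD4 Φ (covD3 Φ (fun i a b => pd3 Φ i a b)) p q i a b x
      = pd5 Φ i a b q p x - dCorrection Φ p q i a b x - dCorrection Φ p q a i b x
        - dCorrection Φ p q b i a x - ∑ m, Γh Φ m p q x * nablaThird Φ m i a b x
        - ∑ m, Γh Φ m p i x * nablaThird Φ q m a b x
        - ∑ m, Γh Φ m p a x * nablaThird Φ q m i b x
        - ∑ m, Γh Φ m p b x * nablaThird Φ q m i a x := by
  have h1 : ∀ m, nablaThird Φ q i m b x = nablaThird Φ q m i b x := fun m =>
    nablaThird_swap_left hΩ hΦ hx q i m b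
  have h2 : ∀ m, nablaThird Φ q i a m x = nablaThird Φ q m i a x := fun m => by
    rw [nablaThird_swap_right hΩ hΦ hx, nablaThird_swap_left hΩ hΦ hx]
  simp only [covD4, pd_covD3 hΩ hΦ hpos hx, covD3_eq_nablaThird hΩ hΦ hx, h1, h2]

theorem ihess_symm (hpos : ∀ x ∈ Ω, (hess Φ x).PosDef) (hx : x ∈ Ω) (r s : Fin n) :
    ihess Φ x r s = ihess Φ x s r := by
  have h := (hpos x hx).1.inv.apply s r
  simpa [ihess] using h

theorem trace_mat3_swap (hΩ : IsOpen Ω) (hΦ : ContDiffOn ℝ 5 Φ Ω)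
    (hpos : ∀ x ∈ Ω, (hess Φ x).PosDef) (hx : x ∈ Ω) (i a b : Fin n) :
    (ihess Φ x * mat3 Φ i x * ihess Φ x * mat3 Φ b x * ihess Φ x * mat3 Φ a x).trace
      = (ihess Φ x * mat3 Φ i x * ihess Φ x * mat3 Φ a x * ihess Φ x * mat3 Φ b x).trace :=
  trace_cycle_swap (ihess Φ x) (fun r s t => pd3 Φ r s t x) (ihess_symm hpos hx)
    (fun r s t => pd3_swap_left hΩ hΦ (by norm_num) hx r s t) i a b

theorem sum_ihess_mul_hess (hpos : ∀ x ∈ Ω, (hess Φ x).PosDef) (hx : x ∈ Ω) (u : Fin n → ℝ)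
    (m : Fin n) : ∑ p, ihess Φ x m p * ∑ c, u c * pd2 Φ c p x = u m := by
  have h : hess Φ x * ihess Φ x = 1 :=
    Matrix.mul_nonsing_inv _ (hpos x hx).det_pos.ne'.isUnit
  have h' : Matrix.vecMul u (hess Φ x * ihess Φ x) m = u m := by rw [h, Matrix.vecMul_one]
  rw [← Matrix.vecMul_vecMul] at h'
  rw [← h']
  refine Finset.sum_congr rfl fun p _ => ?_
  rw [ihess_symm hpos hx m p, mul_comm]
  rfl

/-- The contraction `Σ W^c Φ^{mp} Φ_{cpi} Φ_{mab}`. -/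
def gradThird {n : ℕ} (Φ W : (Fin n → ℝ) → ℝ) (i a b : Fin n) (x : Fin n → ℝ) : ℝ :=
  ∑ m, ∑ p, ∑ c, ihess Φ x m p * (pd W c (grad Φ x) * pd3 Φ c p i x) * pd3 Φ m a b x

/-- The contraction `Σ W^{mp} Φ_{pi} Φ_{mab}`. -/
def hessThird {n : ℕ} (Φ W : (Fin n → ℝ) → ℝ) (i a b : Fin n) (x : Fin n → ℝ) : ℝ :=
  ∑ m, (∑ p, pd2 W m p (grad Φ x) * pd2 Φ p i x) * pd3 Φ m a b x

/-- The contraction `Σ Φ^{km} Φ^{pq} Φ_{pqmi} Φ_{kab}`. -/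
def fourthThird {n : ℕ} (Φ : (Fin n → ℝ) → ℝ) (i a b : Fin n) (x : Fin n → ℝ) : ℝ :=
  ∑ k, ∑ m, ihess Φ x k m * (ihess Φ x * mat4 Φ m i x).trace * pd3 Φ k a b x

/-- The contraction `Σ Φ^{km} g_{mi} Φ_{kab}`. -/
def calabiThird {n : ℕ} (Φ : (Fin n → ℝ) → ℝ) (i a b : Fin n) (x : Fin n → ℝ) : ℝ :=
  ∑ k, ∑ m, ihess Φ x k m * (ihess Φ x * mat3 Φ m x * ihess Φ x * mat3 Φ i x).trace
    * pd3 Φ k a b x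

theorem contract_hess_potential (hΩ : IsOpen Ω) (hΦ : ContDiffOn ℝ 5 Φ Ω)
    (hpos : ∀ x ∈ Ω, (hess Φ x).PosDef) (hW : ContDiff ℝ 3 W)
    (hMA : ∀ x ∈ Ω, Real.exp (-V x) = Real.exp (-W (grad Φ x)) * (hess Φ x).det) (hx : x ∈ Ω)
    (i a b : Fin n) :
    ∑ m, ((∑ p, ihess Φ x m p * pd2 V p i x)
        + (∑ p, pd2 W m p (grad Φ x) * pd2 Φ p i x)) * pd3 Φ m a b x
      = 2 * hessThird Φ W i a b x + gradThird Φ W i a b x - fourthThird Φ i a b x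
        + calabiThird Φ i a b x := by
  have hV : ∀ m, ∑ p, ihess Φ x m p * pd2 V p i x
      = (∑ d, pd2 W m d (grad Φ x) * pd2 Φ d i x)
        + (∑ p, ihess Φ x m p * ∑ c, pd W c (grad Φ x) * pd3 Φ c p i x)
        - (∑ p, ihess Φ x m p * (ihess Φ x * mat4 Φ p i x).trace)
        + ∑ p, ihess Φ x m p * (ihess Φ x * mat3 Φ p x * ihess Φ x * mat3 Φ i x).trace := by
    intro m
    rw [← sum_ihess_mul_hess hpos hx (fun c => ∑ d, pd2 W c d (grad Φ x) * pd2 Φ d i x) m,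
      ← Finset.sum_add_distrib, ← Finset.sum_sub_distrib, ← Finset.sum_add_distrib]
    refine Finset.sum_congr rfl fun p _ => ?_
    have hc := Matrix.trace_mul_comm (ihess Φ x * mat3 Φ i x) (ihess Φ x * mat3 Φ p x)
    simp only [← Matrix.mul_assoc] at hc
    rw [pd2_potential hΩ hΦ hpos hW hMA hx p i, Matrix.trace_sub, hc, Finset.sum_add_distrib]
    ring
  rw [hessThird, gradThird, fourthThird, calabiThird, Finset.mul_sum, ← Finset.sum_add_distrib,
    ← Finset.sum_sub_distrib, ← Finset.sum_add_distrib]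
  refine Finset.sum_congr rfl fun m _ => ?_
  rw [hV m]
  simp only [← Finset.sum_mul, ← Finset.mul_sum]
  ring

theorem pd3_potential_eq (hΩ : IsOpen Ω) (hΦ : ContDiffOn ℝ 5 Φ Ω)
    (hpos : ∀ x ∈ Ω, (hess Φ x).PosDef) (hW : ContDiff ℝ 3 W)
    (hMA : ∀ x ∈ Ω, Real.exp (-V x) = Real.exp (-W (grad Φ x)) * (hess Φ x).det) (hx : x ∈ Ω)
    (i a b : Fin n) :
    pd3 V i a b x = What3 Φ W i a b x + hessThird Φ W i a b x + hessThird Φ W a i b x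
        + hessThird Φ W b i a x + (∑ c, pd W c (grad Φ x) * pd4 Φ i a b c x)
        - (∑ p, ∑ q, ihess Φ x p q * pd5 Φ i a b q p x)
        + (ihess Φ x * mat3 Φ i x * ihess Φ x * mat4 Φ a b x).trace
        + (ihess Φ x * mat3 Φ a x * ihess Φ x * mat4 Φ i b x).trace
        + (ihess Φ x * mat3 Φ b x * ihess Φ x * mat4 Φ i a x).trace
        - 2 * (ihess Φ x * mat3 Φ i x * ihess Φ x * mat3 Φ a x * ihess Φ x * mat3 Φ b x).trace := by
  have hW2 : ∀ c d, pd2 W c d (grad Φ x) = pd2 W d c (grad Φ x) := fun c d =>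
    pd2_comm_s7 isOpen_univ hW.contDiffOn (by norm_num) (Set.mem_univ _) c d
  have h5 : (ihess Φ x * mat5 Φ i a b x).trace
      = ∑ p, ∑ q, ihess Φ x p q * pd5 Φ i a b q p x := by
    simp only [Matrix.trace, Matrix.diag_apply, Matrix.mul_apply, mat5, Matrix.of_apply]
    refine Finset.sum_congr rfl fun p _ => Finset.sum_congr rfl fun q _ => ?_
    rw [pd5_rotate hΩ hΦ le_rfl hx, pd5_swap_right hΩ hΦ le_rfl hx]
  have h4 : ∀ c, pd4 Φ c i a b x = pd4 Φ i a b c x := fun c => by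
    rw [pd4_swap_left hΩ hΦ (by norm_num) hx, pd4_swap_mid hΩ hΦ (by norm_num) hx,
      pd4_swap_right hΩ hΦ (by norm_num) hx]
  have hA : ∑ c, (∑ d, (∑ e, pd3 W c d e (grad Φ x) * pd2 Φ e b x) * pd2 Φ d a x) * pd2 Φ c i x
      = What3 Φ W i a b x := by
    simp only [What3, Finset.sum_mul]
    refine Finset.sum_congr rfl fun c _ => Finset.sum_congr rfl fun d _ =>
      Finset.sum_congr rfl fun e _ => ?_
    ring
  have hB : ∑ c, (∑ d, pd2 W c d (grad Φ x) * pd3 Φ d a b x) * pd2 Φ c i x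
      = hessThird Φ W i a b x := by
    simp only [hessThird, Finset.sum_mul]
    rw [Finset.sum_comm]
    refine Finset.sum_congr rfl fun c _ => Finset.sum_congr rfl fun d _ => ?_
    rw [hW2 d c]
    ring
  rw [pd3_potential hΩ hΦ hpos hW hMA hx i a b, h5, trace_mat3_swap hΩ hΦ hpos hx,
    ← hA, ← hB, hessThird, hessThird]
  simp only [Finset.sum_add_distrib, add_mul, h4]
  ring

theorem contract_first_order (hΩ : IsOpen Ω) (hΦ : ContDiffOn ℝ 5 Φ Ω)
    (hpos : ∀ x ∈ Ω, (hess Φ x).PosDef) (hW : ContDiff ℝ 3 W)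
    (hMA : ∀ x ∈ Ω, Real.exp (-V x) = Real.exp (-W (grad Φ x)) * (hess Φ x).det) (hx : x ∈ Ω)
    (X : Fin n → ℝ) :
    (∑ p, ∑ q, ihess Φ x p q * ∑ m, Γh Φ m p q x * X m)
        + (1 / 2) * ∑ p, ((∑ m, ihess Φ x p m * pd V m x) + Wop Φ W p x) * X p
      = ∑ p, pd W p (grad Φ x) * X p := by
  have hV : ∀ p, ∑ m, ihess Φ x p m * pd V m x
      = pd W p (grad Φ x) - ∑ m, ihess Φ x p m * (ihess Φ x * mat3 Φ m x).trace := by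
    intro p
    rw [← sum_ihess_mul_hess hpos hx (fun c => pd W c (grad Φ x)) p, ← Finset.sum_sub_distrib]
    refine Finset.sum_congr rfl fun m _ => ?_
    rw [pd_potential hΩ hΦ hpos hW hMA hx m]
    ring
  have hΓ : ∑ p, ∑ q, ihess Φ x p q * ∑ m, Γh Φ m p q x * X m
      = (1 / 2) * ∑ m, (∑ k, ihess Φ x m k * (ihess Φ x * mat3 Φ k x).trace) * X m := by
    have h := contract_christoffel (ihess Φ x) (fun r s t => pd3 Φ r s t x)
      (fun r s t => pd3_swap_left hΩ hΦ (by norm_num) hx r s t)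
      (fun r s t => pd3_swap_right hΩ hΦ (by norm_num) hx r s t) X
    simp only [Finset.sum_mul]
    refine Eq.trans ?_ (congrArg (fun t => (1 / 2) * t) h)
    simp only [Γh, Finset.mul_sum, Finset.sum_mul]
    refine Finset.sum_congr rfl fun p _ => Finset.sum_congr rfl fun q _ =>
      Finset.sum_congr rfl fun m _ => Finset.sum_congr rfl fun k _ => ?_
    ring
  rw [hΓ, ← mul_add, ← Finset.sum_add_distrib, Finset.mul_sum]
  refine Finset.sum_congr rfl fun p _ => ?_
  rw [hV p, Wop]
  ring

theorem contract_grad_nablaThird (hΩ : IsOpen Ω) (hΦ : ContDiffOn ℝ 5 Φ Ω) (hx : x ∈ Ω)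
    (i a b : Fin n) :
    ∑ p, pd W p (grad Φ x) * nablaThird Φ p i a b x
      = (∑ p, pd W p (grad Φ x) * pd4 Φ i a b p x)
        - (1 / 2) * (gradThird Φ W i a b x + gradThird Φ W a i b x + gradThird Φ W b i a x) := by
  have h : ∀ i a b : Fin n,
      ∑ p, pd W p (grad Φ x) * ∑ m, Γh Φ m p i x * pd3 Φ m a b x
        = (1 / 2) * gradThird Φ W i a b x := by
    intro i a b
    simp only [Γh, gradThird, Finset.mul_sum, Finset.sum_mul]
    rw [Finset.sum_comm]
    refine Finset.sum_congr rfl fun m _ => ?_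
    rw [Finset.sum_comm]
    refine Finset.sum_congr rfl fun k _ => Finset.sum_congr rfl fun p _ => ?_
    rw [pd3_swap_left hΩ hΦ (by norm_num) hx k p i]
    ring
  simp only [nablaThird, mul_sub, Finset.sum_sub_distrib, h]
  ring

theorem contract_dCorrection (hΩ : IsOpen Ω) (hΦ : ContDiffOn ℝ 5 Φ Ω)
    (hpos : ∀ x ∈ Ω, (hess Φ x).PosDef) (hx : x ∈ Ω) (i a b : Fin n) :
    ∑ p, ∑ q, ihess Φ x p q * dCorrection Φ p q i a b x
      = -(1 / 2) * calabiThird Φ i a b x + (1 / 2) * fourthThird Φ i a b x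
        + (1 / 2) * (ihess Φ x * mat3 Φ i x * ihess Φ x * mat4 Φ a b x).trace :=
  contract_deriv_correction (ihess Φ x) (fun r s t => pd3 Φ r s t x)
    (fun r s t u => pd4 Φ r s t u x) (ihess_symm hpos hx)
    (fun r s t => pd3_swap_left hΩ hΦ (by norm_num) hx r s t)
    (fun r s t => pd3_swap_right hΩ hΦ (by norm_num) hx r s t)
    (fun r s t u => pd4_swap_left hΩ hΦ (by norm_num) hx r s t u)
    (fun r s t u => pd4_swap_mid hΩ hΦ (by norm_num) hx r s t u)
    (fun r s t u => pd4_swap_right hΩ hΦ (by norm_num) hx r s t u) i a b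

theorem contract_nablaThird (hΩ : IsOpen Ω) (hΦ : ContDiffOn ℝ 5 Φ Ω)
    (hpos : ∀ x ∈ Ω, (hess Φ x).PosDef) (hx : x ∈ Ω) (i a b : Fin n) :
    ∑ p, ∑ q, ihess Φ x p q * ∑ m, Γh Φ m p i x * nablaThird Φ q m a b x
      = (1 / 2) * (ihess Φ x * mat3 Φ i x * ihess Φ x * mat4 Φ a b x).trace
        - (1 / 4) * calabiThird Φ i a b x
        - (1 / 2)
          * (ihess Φ x * mat3 Φ i x * ihess Φ x * mat3 Φ a x * ihess Φ x * mat3 Φ b x).trace :=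
  contract_correction (ihess Φ x) (fun r s t => pd3 Φ r s t x)
    (fun r s t u => pd4 Φ r s t u x) (ihess_symm hpos hx)
    (fun r s t => pd3_swap_left hΩ hΦ (by norm_num) hx r s t)
    (fun r s t => pd3_swap_right hΩ hΦ (by norm_num) hx r s t)
    (fun r s t u => pd4_swap_left hΩ hΦ (by norm_num) hx r s t u)
    (fun r s t u => pd4_swap_mid hΩ hΦ (by norm_num) hx r s t u)
    (fun r s t u => pd4_swap_right hΩ hΦ (by norm_num) hx r s t u) i a b

theorem calabi_eq_trace (hΩ : IsOpen Ω) (hΦ : ContDiffOn ℝ 5 Φ Ω)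
    (hpos : ∀ x ∈ Ω, (hess Φ x).PosDef) (hx : x ∈ Ω) (i j : Fin n) :
    calabi Φ i j x = (ihess Φ x * mat3 Φ i x * ihess Φ x * mat3 Φ j x).trace :=
  pair_sum_eq_trace (ihess Φ x) (fun r s t => pd3 Φ r s t x) (ihess_symm hpos hx)
    (fun r s t => pd3_swap_left hΩ hΦ (by norm_num) hx r s t)
    (fun r s t => pd3_swap_right hΩ hΦ (by norm_num) hx r s t) i j

theorem trace_mat3_rotate (i a b : Fin n) :
    (ihess Φ x * mat3 Φ b x * ihess Φ x * mat3 Φ i x * ihess Φ x * mat3 Φ a x).trace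
      = (ihess Φ x * mat3 Φ i x * ihess Φ x * mat3 Φ a x * ihess Φ x * mat3 Φ b x).trace := by
  have h := Matrix.trace_mul_comm (ihess Φ x * mat3 Φ b x)
    (ihess Φ x * mat3 Φ i x * ihess Φ x * mat3 Φ a x)
  simpa only [← Matrix.mul_assoc] using h

theorem LT3_third (hΩ : IsOpen Ω) (hΦ : ContDiffOn ℝ 5 Φ Ω)
    (hpos : ∀ x ∈ Ω, (hess Φ x).PosDef) (hW : ContDiff ℝ 3 W)
    (hMA : ∀ x ∈ Ω, Real.exp (-V x) = Real.exp (-W (grad Φ x)) * (hess Φ x).det) (hx : x ∈ Ω)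
    (i a b : Fin n) :
    LT3 Φ V W (fun i a b => pd3 Φ i a b) i a b x
      = (∑ p, ∑ q, ihess Φ x p q * pd5 Φ i a b q p x)
        - (∑ p, pd W p (grad Φ x) * pd4 Φ i a b p x)
        + (1 / 2) * (gradThird Φ W i a b x + gradThird Φ W a i b x + gradThird Φ W b i a x)
        - (1 / 2) * (fourthThird Φ i a b x + fourthThird Φ a i b x + fourthThird Φ b i a x)
        + (3 / 4) * (calabiThird Φ i a b x + calabiThird Φ a i b x + calabiThird Φ b i a x)
        - (ihess Φ x * mat3 Φ i x * ihess Φ x * mat4 Φ a b x).trace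
        - (ihess Φ x * mat3 Φ a x * ihess Φ x * mat4 Φ i b x).trace
        - (ihess Φ x * mat3 Φ b x * ihess Φ x * mat4 Φ i a x).trace
        + (3 / 2)
          * (ihess Φ x * mat3 Φ i x * ihess Φ x * mat3 Φ a x * ihess Φ x * mat3 Φ b x).trace := by
  have hF := contract_first_order hΩ hΦ hpos hW hMA hx fun p => nablaThird Φ p i a b x
  rw [contract_grad_nablaThird hΩ hΦ hx i a b] at hF
  simp only [LT3, covD4_covD3 hΩ hΦ hpos hx, covD3_eq_nablaThird hΩ hΦ hx, mul_sub,
    Finset.sum_sub_distrib, contract_dCorrection hΩ hΦ hpos hx,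
    contract_nablaThird hΩ hΦ hpos hx]
  rw [trace_mat3_rotate i a b, trace_mat3_swap hΩ hΦ hpos hx a b i, trace_mat3_rotate b i a,
    trace_mat3_rotate i a b]
  linarith

end Laplacian

/-- the weighted tensor Laplacian of the (0,3)-tensor `T_{iab} = Φ_{iab}`. -/
theorem stmt_7 {n : ℕ} (Ω : Set (Fin n → ℝ)) (hΩ : IsOpen Ω)
    (Φ V W : (Fin n → ℝ) → ℝ)
    (hΦ : ContDiffOn ℝ 5 Φ Ω) (hΦconv : ConvexOn ℝ Ω Φ)
    (hpos : ∀ x ∈ Ω, (hess Φ x).PosDef)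
    (hV : ContDiffOn ℝ 3 V Ω) (hW : ContDiff ℝ 3 W)
    (hMA : ∀ x ∈ Ω, Real.exp (-V x) = Real.exp (-W (grad Φ x)) * (hess Φ x).det) :
    ∀ x ∈ Ω, ∀ i a b : Fin n,
      LT3 Φ V W (fun i a b => pd3 Φ i a b) i a b x
      = -(pd3 V i a b x) + What3 Φ W i a b x
        + (1/2) * ∑ m,
          (((∑ p, ihess Φ x m p * pd2 V p i x)
              + (∑ p, pd2 W m p (grad Φ x) * pd2 Φ p i x)) * pd3 Φ m a b x
            + ((∑ p, ihess Φ x m p * pd2 V p a x)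
              + (∑ p, pd2 W m p (grad Φ x) * pd2 Φ p a x)) * pd3 Φ m i b x
            + ((∑ p, ihess Φ x m p * pd2 V p b x)
              + (∑ p, pd2 W m p (grad Φ x) * pd2 Φ p b x)) * pd3 Φ m i a x)
        - (1/2) * ∑ l, ∑ p, ∑ m, ∑ q, ∑ k, ∑ r,
            ihess Φ x l p * pd3 Φ p i k x * ihess Φ x m q * pd3 Φ q a l x
              * ihess Φ x k r * pd3 Φ r b m x
        + (1/4) * ∑ k, ∑ m,
            (ihess Φ x k m * calabi Φ m i x * pd3 Φ k a b x
              + ihess Φ x k m * calabi Φ m a x * pd3 Φ k i b x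
              + ihess Φ x k m * calabi Φ m b x * pd3 Φ k i a x) := by
  intro x hx i a b
  have hcycle : ∑ l, ∑ p, ∑ m, ∑ q, ∑ k, ∑ r,
      ihess Φ x l p * pd3 Φ p i k x * ihess Φ x m q * pd3 Φ q a l x
        * ihess Φ x k r * pd3 Φ r b m x
      = (ihess Φ x * mat3 Φ i x * ihess Φ x * mat3 Φ b x * ihess Φ x * mat3 Φ a x).trace :=
    cycle_sum_eq_trace (ihess Φ x) (fun r s t => pd3 Φ r s t x)
      (fun r s t => pd3_swap_left hΩ hΦ (by norm_num) hx r s t)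
      (fun r s t => pd3_swap_right hΩ hΦ (by norm_num) hx r s t) i a b
  have hcalabi : ∑ k, ∑ m, (ihess Φ x k m * calabi Φ m i x * pd3 Φ k a b x
        + ihess Φ x k m * calabi Φ m a x * pd3 Φ k i b x
        + ihess Φ x k m * calabi Φ m b x * pd3 Φ k i a x)
      = calabiThird Φ i a b x + calabiThird Φ a i b x + calabiThird Φ b i a x := by
    simp only [calabi_eq_trace hΩ hΦ hpos hx, Finset.sum_add_distrib, calabiThird]
  rw [LT3_third hΩ hΦ hpos hW hMA hx, pd3_potential_eq hΩ hΦ hpos hW hMA hx, hcycle, hcalabi,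
    trace_mat3_swap hΩ hΦ hpos hx, Finset.sum_add_distrib, Finset.sum_add_distrib,
    contract_hess_potential hΩ hΦ hpos hW hMA hx, contract_hess_potential hΩ hΦ hpos hW hMA hx,
    contract_hess_potential hΩ hΦ hpos hW hMA hx]
  ring
end
end
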